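/- arXiv:1501.06747 — 12 statements merged into one kernel-verified Lean document; each statement's English description precedes it below -/
import Mathlib

section
/- Let n ≥ 2 and suppose E = ⋃_{i=1}^{n-1} E_i is a subset of n-dimensional Euclidean space ℝⁿ, where each E_i is a closed convex set. Then E is 1-convex: for every point x ∈ ℝⁿ \ E there exists a line through x that is disjoint from E. -/
/-- A union of `n-1` closed convex sets in `ℝⁿ` is 1-convex: through every point of the
complement there is a line disjoint from the union. -/
theorem union_convex_one_convex (n : ℕ) (hn : 2 ≤ n)
    (E : Fin (n - 1) → Set (EuclideanSpace ℝ (Fin n)))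
    (hclosed : ∀ i, IsClosed (E i)) (hconv : ∀ i, Convex ℝ (E i))
    (x : EuclideanSpace ℝ (Fin n)) (hx : x ∉ ⋃ i, E i) :
    ∃ v : EuclideanSpace ℝ (Fin n), v ≠ 0 ∧ ∀ t : ℝ, x + t • v ∉ ⋃ i, E i := by
  simp only [Set.mem_iUnion, not_exists] at hx ⊢
  choose f u hfx hfE using fun i ↦
    geometric_hahn_banach_point_closed (hconv i) (hclosed i) (hx i)
  have hker : LinearMap.ker (LinearMap.pi fun i ↦ (f i).toLinearMap) ≠ ⊥ := by
    apply LinearMap.ker_ne_bot_of_finrank_lt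
    simp only [Module.finrank_fin_fun, finrank_euclideanSpace_fin]
    omega
  obtain ⟨v, hv, hv0⟩ := Submodule.exists_mem_ne_zero_of_ne_bot hker
  refine ⟨v, hv0, fun t i hmem ↦ ?_⟩
  have hfv : f i v = 0 := congrFun (LinearMap.mem_ker.mp hv) i
  have hlt := hfE i _ hmem
  rw [map_add, map_smul, hfv, smul_zero, add_zero] at hlt
  exact lt_asymm hlt (hfx i)
end

section
/- Let 2 ≤ m < n and suppose E = ⋃_{i=1}^{m-1} E_i is a subset of n-dimensional Euclidean space ℝⁿ, where each E_i is a closed convex set. Then E is (n−m)-convex: for every point x ∈ ℝⁿ \ E there exists an affine subspace of ℝⁿ of dimension n−m containing x that is disjoint from E. -/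
/-- Below every subspace of finite dimension at least `k` there is one of dimension exactly `k`. -/
theorem Submodule.exists_le_finrank_eq_of_le {K V : Type*} [DivisionRing K] [AddCommGroup V]
    [Module K V] (W : Submodule K V) {k : ℕ} (hk : k ≤ Module.finrank K W) :
    ∃ U ≤ W, Module.finrank K U = k := by
  obtain ⟨f, hf⟩ := exists_linearIndependent_of_le_finrank hk
  refine ⟨(span K (Set.range f)).map W.subtype, map_subtype_le _ _, ?_⟩
  rw [finrank_map_subtype_eq, finrank_span_eq_card hf, Fintype.card_fin]

/-- A union of `m-1` closed convex sets in `ℝⁿ` (for `2 ≤ m < n`) is `(n-m)`-convex: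
through every point of the complement there is an affine subspace of dimension `n - m`
disjoint from the union. -/
theorem union_convex_nm_convex (n m : ℕ) (hm : 2 ≤ m) (hmn : m < n)
    (E : Fin (m - 1) → Set (EuclideanSpace ℝ (Fin n)))
    (hclosed : ∀ i, IsClosed (E i)) (hconv : ∀ i, Convex ℝ (E i))
    (x : EuclideanSpace ℝ (Fin n)) (hx : x ∉ ⋃ i, E i) :
    ∃ L : AffineSubspace ℝ (EuclideanSpace ℝ (Fin n)),
      Module.finrank ℝ L.direction = n - m ∧ x ∈ L ∧
      Disjoint (L : Set (EuclideanSpace ℝ (Fin n))) (⋃ i, E i) := by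
  have hsep : ∀ i, ∃ f : StrongDual ℝ (EuclideanSpace ℝ (Fin n)), ∀ y ∈ E i, f x < f y := by
    intro i
    obtain ⟨f, u, hxu, huy⟩ := geometric_hahn_banach_point_closed (hconv i) (hclosed i)
      (fun h => hx (Set.mem_iUnion_of_mem i h))
    exact ⟨f, fun y hy => hxu.trans (huy y hy)⟩
  choose f hf using hsep
  let F : EuclideanSpace ℝ (Fin n) →ₗ[ℝ] (Fin (m - 1) → ℝ) := LinearMap.pi fun i => f i
  have hker : n - m ≤ Module.finrank ℝ (LinearMap.ker F) := by
    have hrank := F.finrank_range_add_finrank_ker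
    have hrange := Submodule.finrank_le (LinearMap.range F)
    simp only [finrank_euclideanSpace, Module.finrank_fin_fun, Fintype.card_fin] at hrank hrange
    omega
  obtain ⟨U, hU, hdim⟩ := Submodule.exists_le_finrank_eq_of_le _ hker
  refine ⟨AffineSubspace.mk' x U, by rwa [AffineSubspace.direction_mk'],
    AffineSubspace.self_mem_mk' x U, Set.disjoint_left.2 fun y hy hyE => ?_⟩
  obtain ⟨i, hi⟩ := Set.mem_iUnion.1 hyE
  have hyx : F (y - x) = 0 := hU (AffineSubspace.mem_mk'.1 hy)
  have hfi : f i (y - x) = 0 := congrFun hyx i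
  rw [map_sub, sub_eq_zero] at hfi
  exact (hf i y hi).ne' hfi
end

section
/- There exist two disjoint closed discs D₁, D₂ in the Euclidean plane ℝ², whose centers lie on the unit circle (have norm 1) and whose radii are positive and strictly less than 1, such that every line through the origin intersects D₁ ∪ D₂. -/
/-- There exist two disjoint closed discs with centers on the unit circle and radii in `(0,1)`
such that every line through the origin meets their union. -/
theorem shadow_two_discs_lines :
    ∃ (c₁ c₂ : EuclideanSpace ℝ (Fin 2)) (r₁ r₂ : ℝ),
      ‖c₁‖ = 1 ∧ ‖c₂‖ = 1 ∧ 0 < r₁ ∧ r₁ < 1 ∧ 0 < r₂ ∧ r₂ < 1 ∧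
      Disjoint (Metric.closedBall c₁ r₁) (Metric.closedBall c₂ r₂) ∧
      ∀ v : EuclideanSpace ℝ (Fin 2), v ≠ 0 →
        ∃ t : ℝ, t • v ∈ Metric.closedBall c₁ r₁ ∪ Metric.closedBall c₂ r₂ := by
  refine ⟨!₂[1, 0], !₂[0, 1], 3 / 5, 4 / 5, ?_, ?_, by norm_num, by norm_num, by norm_num,
    by norm_num, ?_, ?_⟩
  · simp [EuclideanSpace.norm_eq]
  · simp [EuclideanSpace.norm_eq]
  · apply Metric.closedBall_disjoint_closedBall
    rw [EuclideanSpace.dist_eq]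
    apply Real.lt_sqrt_of_sq_lt
    simp [Fin.sum_univ_two, Real.dist_eq]
    norm_num
  · intro v hv
    have hs : 0 < v 0 ^ 2 + v 1 ^ 2 := by
      have h := EuclideanSpace.real_norm_sq_eq v
      rw [Fin.sum_univ_two] at h
      rw [← h]
      positivity
    -- The line in direction `v` is at distance `|v 1| / ‖v‖` from the first center and
    -- `|v 0| / ‖v‖` from the second; `t` gives the foot of the perpendicular.
    rcases le_total (v 1 ^ 2) (9 / 25 * (v 0 ^ 2 + v 1 ^ 2)) with h | h
    · refine ⟨v 0 / (v 0 ^ 2 + v 1 ^ 2), Or.inl ?_⟩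
      rw [Metric.mem_closedBall, EuclideanSpace.dist_eq]
      apply Real.sqrt_le_iff.mpr ⟨by norm_num, ?_⟩
      simp only [Fin.sum_univ_two, Real.dist_eq, sq_abs, PiLp.smul_apply, smul_eq_mul,
        Matrix.cons_val_zero, Matrix.cons_val_one]
      calc _ = v 1 ^ 2 / (v 0 ^ 2 + v 1 ^ 2) := by field_simp; ring
        _ ≤ _ := by rw [div_le_iff₀ hs]; linarith
    · refine ⟨v 1 / (v 0 ^ 2 + v 1 ^ 2), Or.inr ?_⟩
      rw [Metric.mem_closedBall, EuclideanSpace.dist_eq]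
      apply Real.sqrt_le_iff.mpr ⟨by norm_num, ?_⟩
      simp only [Fin.sum_univ_two, Real.dist_eq, sq_abs, PiLp.smul_apply, smul_eq_mul,
        Matrix.cons_val_zero, Matrix.cons_val_one]
      calc _ = v 0 ^ 2 / (v 0 ^ 2 + v 1 ^ 2) := by field_simp; ring
        _ ≤ _ := by rw [div_le_iff₀ hs]; linarith
end

section
/- For every n ≥ 2 there exist two disjoint closed balls B₁, B₂ in n-dimensional Euclidean space ℝⁿ, whose centers lie on the unit sphere S^{n−1} (have norm 1) and whose radii are positive and strictly less than 1, such that every (n−1)-dimensional affine subspace of ℝⁿ containing the origin intersects B₁ ∪ B₂. -/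
/-- A subspace of codimension one is the orthogonal complement of a unit vector. -/
lemma exists_unit_normal_of_finrank_add_one {E : Type*} [NormedAddCommGroup E]
    [InnerProductSpace ℝ E] [FiniteDimensional ℝ E] (W : Submodule ℝ E)
    (hW : Module.finrank ℝ W + 1 = Module.finrank ℝ E) :
    ∃ u : E, ‖u‖ = 1 ∧ W = (ℝ ∙ u)ᗮ := by
  have h1 : Module.finrank ℝ Wᗮ = 1 := by
    have := W.finrank_add_finrank_orthogonal
    omega
  obtain ⟨v, hv0, hv⟩ := finrank_eq_one_iff'.mp h1
  have hv0' : (v : E) ≠ 0 := fun h => hv0 (Subtype.ext h)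
  refine ⟨(‖(v : E)‖⁻¹ : ℝ) • (v : E), norm_smul_inv_norm (𝕜 := ℝ) hv0', ?_⟩
  have hspan : Wᗮ = ℝ ∙ ((‖(v : E)‖⁻¹ : ℝ) • (v : E)) := by
    rw [Submodule.span_singleton_smul_eq (by simpa using hv0')]
    apply le_antisymm
    · intro w hw
      obtain ⟨c, hc⟩ := hv ⟨w, hw⟩
      exact Submodule.mem_span_singleton.mpr ⟨c, congrArg Subtype.val hc⟩
    · exact (Submodule.span_singleton_le_iff_mem _ _).mpr v.2
  rw [← hspan, Submodule.orthogonal_orthogonal]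

/-- The hyperplane orthogonal to a unit vector `u` contains a point at distance `|⟪u, c⟫|`
from `c`. -/
lemma exists_mem_orthogonal_dist_eq {E : Type*} [NormedAddCommGroup E]
    [InnerProductSpace ℝ E] (u c : E) (hu : ‖u‖ = 1) :
    ∃ x ∈ (ℝ ∙ u)ᗮ, dist x c = |inner ℝ u c| := by
  refine ⟨c - inner ℝ u c • u, ?_, ?_⟩
  · rw [Submodule.mem_orthogonal_singleton_iff_inner_right, inner_sub_right, inner_smul_right,
      real_inner_self_eq_norm_sq, hu]
    ring
  · simp [norm_smul, hu]

/-- For every `n ≥ 2` there are two disjoint closed balls with centers on the unit sphere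
and radii in `(0,1)` such that every hyperplane (affine subspace of dimension `n-1`)
through the origin meets their union. -/
theorem shadow_two_balls_hyperplanes (n : ℕ) (hn : 2 ≤ n) :
    ∃ (c₁ c₂ : EuclideanSpace ℝ (Fin n)) (r₁ r₂ : ℝ),
      ‖c₁‖ = 1 ∧ ‖c₂‖ = 1 ∧ 0 < r₁ ∧ r₁ < 1 ∧ 0 < r₂ ∧ r₂ < 1 ∧
      Disjoint (Metric.closedBall c₁ r₁) (Metric.closedBall c₂ r₂) ∧
      ∀ L : AffineSubspace ℝ (EuclideanSpace ℝ (Fin n)),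
        Module.finrank ℝ L.direction = n - 1 →
        (0 : EuclideanSpace ℝ (Fin n)) ∈ L →
        ((L : Set (EuclideanSpace ℝ (Fin n))) ∩
          (Metric.closedBall c₁ r₁ ∪ Metric.closedBall c₂ r₂)).Nonempty := by
  let i : Fin n := ⟨0, by omega⟩
  let j : Fin n := ⟨1, by omega⟩
  have hij : i ≠ j := by simp [i, j]
  refine ⟨EuclideanSpace.single i 1, EuclideanSpace.single j 1, 3 / 5, 4 / 5, by simp, by simp,
    by norm_num, by norm_num, by norm_num, by norm_num, ?_, ?_⟩
  · apply Metric.closedBall_disjoint_closedBall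
    have hd : dist (EuclideanSpace.single i (1 : ℝ)) (EuclideanSpace.single j 1) ^ 2 = 2 := by
      rw [dist_eq_norm, norm_sub_sq_real]
      simp [EuclideanSpace.inner_single_left, hij]
      norm_num
    nlinarith [dist_nonneg (x := EuclideanSpace.single i (1 : ℝ)) (y := EuclideanSpace.single j 1)]
  · intro L hL h0
    obtain ⟨u, hu, hLu⟩ := exists_unit_normal_of_finrank_add_one L.direction
      (by rw [hL, finrank_euclideanSpace_fin]; omega)
    have hmem : ∀ x ∈ (ℝ ∙ u)ᗮ, x ∈ L := fun x hx => by
      simpa using AffineSubspace.vadd_mem_of_mem_direction (hLu ▸ hx) h0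
    have hcoord : u i ^ 2 + u j ^ 2 ≤ 1 := by
      have hsum : ∑ k, u k ^ 2 = 1 := by
        rw [← EuclideanSpace.real_norm_sq_eq, hu, one_pow]
      rw [← hsum, ← Finset.sum_pair (f := fun k => u k ^ 2) hij]
      exact Finset.sum_le_univ_sum_of_nonneg fun k => sq_nonneg _
    rcases le_or_gt |u i| (3 / 5) with h | h
    · obtain ⟨x, hx, hxd⟩ := exists_mem_orthogonal_dist_eq u (EuclideanSpace.single i 1) hu
      refine ⟨x, hmem x hx, Or.inl ?_⟩
      rw [Metric.mem_closedBall, hxd]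
      simpa [EuclideanSpace.inner_single_right] using h
    · obtain ⟨x, hx, hxd⟩ := exists_mem_orthogonal_dist_eq u (EuclideanSpace.single j 1) hu
      refine ⟨x, hmem x hx, Or.inr ?_⟩
      rw [Metric.mem_closedBall, hxd]
      have hj : |u j| ≤ 4 / 5 := by
        refine abs_le_of_sq_le_sq ?_ (by norm_num)
        nlinarith [sq_abs (u i)]
      simpa [EuclideanSpace.inner_single_right] using hj
end

section
/- Let B₁, B₂, B₃ be three pairwise disjoint closed balls in three-dimensional Euclidean space ℝ³, whose centers lie on the unit sphere S² (have norm 1) and whose radii are positive and strictly less than 1. Then there exists a line through the origin that is disjoint from B₁ ∪ B₂ ∪ B₃. -/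
/-- The Gram determinant of three unit vectors with pairwise inner products `a`, `b`, `c`. -/
def unitGramDet (a b c : ℝ) : ℝ := 1 - a ^ 2 - b ^ 2 - c ^ 2 + 2 * a * b * c

/-- The margin by which the mean square norm of the vertices of the parallelepiped
`|⟪cᵢ, v⟫| ≤ √(1 - rᵢ²)` exceeds `1`, scaled by the Gram determinant. -/
def vertexExcess (p q s a b c : ℝ) : ℝ :=
  (1 - a ^ 2) * (1 - p ^ 2) + (1 - b ^ 2) * (1 - q ^ 2) + (1 - c ^ 2) * (1 - s ^ 2)
    - unitGramDet a b c

lemma vertexExcess_eq (p q s a b c : ℝ) :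
    vertexExcess p q s a b c = 2 - p ^ 2 - q ^ 2 - s ^ 2 + p ^ 2 * a ^ 2 + q ^ 2 * b ^ 2
      + s ^ 2 * c ^ 2 - 2 * a * b * c := by
  unfold vertexExcess unitGramDet
  ring

lemma vertexExcess_rotate (p q s a b c : ℝ) :
    vertexExcess q s p b c a = vertexExcess p q s a b c := by
  simp only [vertexExcess_eq]
  ring

lemma sq_add_sq_le_of_le_one {p q : ℝ} (hp : p ≤ 1) (hq : q ≤ 1) :
    p ^ 2 + q ^ 2 ≤ (p + q - 1) ^ 2 + 1 := by
  nlinarith [mul_nonneg (sub_nonneg.2 hp) (sub_nonneg.2 hq)]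

lemma sq_add_sq_le_of_sq_add_le_two {p q : ℝ} (hp0 : 0 < p) (hp : p ≤ 1) (hq0 : 0 < q)
    (hq : q ≤ 1) (h : (p + q) ^ 2 ≤ 2) : p ^ 2 + q ^ 2 ≤ 6 / 5 := by
  have h1 := sq_add_sq_le_of_le_one hp hq
  have h2 : p + q ≤ 71 / 50 := by nlinarith
  rcases le_total (p + q) 1 with h3 | h3
  · nlinarith [mul_pos hp0 hq0]
  · nlinarith

lemma one_sub_sq_lt {p q z : ℝ} (hp0 : 0 < p) (hp : p < 1) (hq0 : 0 < q) (hq : q < 1)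
    (h : (p + q) ^ 2 ≤ 2 + 2 * z) : 1 - z ^ 2 < 2 * (2 - p ^ 2 - q ^ 2) := by
  rcases le_total ((p + q) ^ 2) 2 with h2 | h2
  · nlinarith [sq_add_sq_le_of_sq_add_le_two hp0 hp.le hq0 hq.le h2, sq_nonneg z]
  · have h1 := sq_add_sq_le_of_le_one hp.le hq.le
    obtain ⟨w, hw⟩ : ∃ w, w = p + q := ⟨_, rfl⟩
    rw [← hw] at h h1 h2
    have hw0 : 0 < w := by linarith
    have hw2 : w < 2 := by linarith
    have hz : (w ^ 2 / 2 - 1) ^ 2 ≤ z ^ 2 := by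
      apply pow_le_pow_left₀ <;> linarith
    have : 0 < w * (2 - w) * (8 - w * (2 + w)) := by
      apply mul_pos (mul_pos hw0 (by linarith))
      nlinarith
    nlinarith

/-- A small ball whose two companions are at an obtuse angle. -/
lemma vertexExcess_pos_of_small_of_obtuse {p q s a b c : ℝ} (hp0 : 0 < p) (hp : p < 1)
    (hq0 : 0 < q) (hq : q < 1) (hs : s ^ 2 ≤ 1 / 2) (hc : c ≤ 0) (hc1 : c ^ 2 ≤ 1)
    (ha : a ^ 2 ≤ s ^ 2) (hb : b ^ 2 ≤ s ^ 2) (h : (p + q) ^ 2 ≤ 2 - 2 * c) :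
    0 < vertexExcess p q s a b c := by
  rw [vertexExcess_eq]
  have h1 : 1 - c ^ 2 < 2 * (2 - p ^ 2 - q ^ 2) := by
    simpa using one_sub_sq_lt (z := -c) hp0 hp hq0 hq (by linarith)
  have hsc : s ^ 2 * (1 - c ^ 2) ≤ 1 / 2 * (1 - c ^ 2) :=
    mul_le_mul_of_nonneg_right hs (by linarith)
  have hpq := mul_pos hp0 hq0
  have hc' : -1 ≤ c := by nlinarith
  rcases le_total 0 (a * b) with hab | hab
  · nlinarith [mul_nonneg hab (neg_nonneg.2 hc), sq_nonneg (p * a), sq_nonneg (q * b)]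
  · rcases le_total (-c) (p * q) with hz | hz
    · nlinarith [sq_nonneg (p * a + q * b),
        mul_nonneg (neg_nonneg.2 hab) (sub_nonneg.2 hz)]
    · have hab' : -(a * b) ≤ s ^ 2 := by nlinarith [sq_nonneg (a + b)]
      have h2 : -(a * b) * (-c - p * q) ≤ s ^ 2 * (-c - p * q) :=
        mul_le_mul_of_nonneg_right hab' (by linarith)
      have h3 : s ^ 2 * (1 - p * q) ≤ 1 / 2 * (1 - p * q) :=
        mul_le_mul_of_nonneg_right hs (by nlinarith)
      have h4 : p ^ 2 + q ^ 2 - p * q < 1 := by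
        nlinarith [mul_pos (sub_pos.2 hp) (sub_pos.2 hq), mul_pos hp0 (sub_pos.2 hp),
          mul_pos hq0 (sub_pos.2 hq), mul_pos hp0 (sub_pos.2 hq), mul_pos hq0 (sub_pos.2 hp)]
      nlinarith [sq_nonneg (p * a + q * b), mul_nonneg (sq_nonneg s) (sq_nonneg (1 + c))]

lemma le_half_of_le_of_le {p q c : ℝ} (hp : c ≤ p) (hq : c ≤ q) (hc : 0 ≤ c)
    (h : (p + q) ^ 2 ≤ 2 - 2 * c) : c ≤ 1 / 2 := by
  nlinarith

/-- Two small balls, each at an acute angle to the pair of the other two. -/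
lemma vertexExcess_pos_of_two_small {p q s a b c : ℝ} (hp0 : 0 < p) (hp : p < 1)
    (hq0 : 0 < q) (hq : q < 1) (hs0 : 0 < s) (hq2 : q ^ 2 ≤ 1 / 2) (hs : s ^ 2 ≤ 1 / 2)
    (hb : 0 < b) (hc : 0 < c) (haq : a ^ 2 ≤ q ^ 2) (has : a ^ 2 ≤ s ^ 2)
    (hbp : b ^ 2 ≤ p ^ 2) (hbs : b ^ 2 ≤ s ^ 2) (hcp : c ^ 2 ≤ p ^ 2) (hcq : c ^ 2 ≤ q ^ 2)
    (hA : (q + s) ^ 2 ≤ 2 - 2 * a) (hB : (p + s) ^ 2 ≤ 2 - 2 * b)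
    (hC : (p + q) ^ 2 ≤ 2 - 2 * c) :
    0 < vertexExcess p q s a b c := by
  rw [vertexExcess_eq]
  have hbc := mul_pos hb hc
  rcases le_total a 0 with ha | ha
  · nlinarith [mul_nonneg (neg_nonneg.2 ha) hbc.le, mul_pos (pow_pos hq0 2) (pow_pos hb 2),
      sq_nonneg (p * a), sq_nonneg (s * c)]
  · have ha2 := le_half_of_le_of_le (abs_le_of_sq_le_sq' haq hq0.le).2
      (abs_le_of_sq_le_sq' has hs0.le).2 ha hA
    have hb2 := le_half_of_le_of_le (abs_le_of_sq_le_sq' hbp hp0.le).2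
      (abs_le_of_sq_le_sq' hbs hs0.le).2 hb.le hB
    have hc2 := le_half_of_le_of_le (abs_le_of_sq_le_sq' hcp hp0.le).2
      (abs_le_of_sq_le_sq' hcq hq0.le).2 hc.le hC
    have h1 : b * c ≤ 1 / 2 * (1 / 2) := mul_le_mul hb2 hc2 hc.le (by norm_num)
    have h2 : a * (b * c) ≤ 1 / 2 * (1 / 2 * (1 / 2)) :=
      mul_le_mul ha2 h1 hbc.le (by norm_num)
    nlinarith [sq_add_sq_le_of_sq_add_le_two hp0 hp.le hq0 hq.le (by linarith),
      sq_nonneg (p * a), sq_nonneg (s * c), sq_nonneg (q * b)]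

lemma large_radii_bound {u w : ℝ} (hu : 0 ≤ u) (hw : 2 ≤ w ^ 2) (hw0 : 0 < w) (hw2 : w < 2) :
    0 < w * (2 - w) * (1 - (1 + u) * (w * (2 + w)) / 8) + u ^ 2 * (3 / 2 * w ^ 2 - 2) := by
  have h1 : 7 / 5 < w := by nlinarith
  have h2 : 1 / 2 * w ≤ 3 / 2 * w ^ 2 - 2 := by nlinarith
  have h3 : u ^ 2 * (1 / 2 * w) ≤ u ^ 2 * (3 / 2 * w ^ 2 - 2) := by gcongr
  have h4 : 0 < w * (2 - w) ^ 2 := mul_pos hw0 (pow_pos (by linarith) 2)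
  have h5 : w * (2 - w) ^ 2 * (1 / 2) < w * (2 - w) ^ 2 * ((4 + w) / 8) :=
    mul_lt_mul_of_pos_left (by linarith) h4
  have h6 : u * w * (2 - w) * (w * (2 + w) / 8) ≤ u * w * (2 - w) * 1 := by
    have : 0 ≤ u * w * (2 - w) := mul_nonneg (mul_nonneg hu hw0.le) (by linarith)
    apply mul_le_mul_of_nonneg_left _ this
    nlinarith
  nlinarith [mul_nonneg hw0.le (sq_nonneg (2 - w - u))]

/-- Three large balls, the last one being the smallest. -/
lemma vertexExcess_pos_of_large {p q s a b c : ℝ} (hp : p < 1) (hq : q < 1) (hs0 : 0 < s)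
    (hs : 1 / 2 ≤ s ^ 2) (hsp : s ≤ p) (hsq : s ≤ q)
    (hA : (q + s) ^ 2 ≤ 2 - 2 * a) (hB : (p + s) ^ 2 ≤ 2 - 2 * b)
    (hC : (p + q) ^ 2 ≤ 2 - 2 * c) :
    0 < vertexExcess p q s a b c := by
  rw [vertexExcess_eq]
  obtain ⟨u, hu⟩ : ∃ u, u = 2 * s ^ 2 - 1 := ⟨_, rfl⟩
  have hu0 : 0 ≤ u := by linarith
  have hua : u ≤ -a := by nlinarith
  have hub : u ≤ -b := by nlinarith
  have h1 := sq_add_sq_le_of_le_one hp.le hq.le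
  have hT : (p + q) ^ 2 / 2 ≤ p ^ 2 + q ^ 2 := by nlinarith [sq_nonneg (p - q)]
  obtain ⟨w, hw⟩ : ∃ w, w = p + q := ⟨_, rfl⟩
  have hw0 : 2 * s ≤ w := by linarith
  have hw2 : w < 2 := by linarith
  rw [← hw] at hC h1 hT
  have hw1 : 2 ≤ w ^ 2 := by linarith [pow_le_pow_left₀ (by linarith) hw0 2, mul_pow 2 s 2]
  have hz : (w ^ 2 / 2 - 1) ^ 2 ≤ c ^ 2 := by
    rw [← neg_sq c]
    apply pow_le_pow_left₀ <;> linarith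
  have ha2 : u ^ 2 ≤ a ^ 2 := by
    rw [← neg_sq a]
    exact pow_le_pow_left₀ hu0 hua 2
  have hb2 : u ^ 2 ≤ b ^ 2 := by
    rw [← neg_sq b]
    exact pow_le_pow_left₀ hu0 hub 2
  have hab : u ^ 2 ≤ a * b := by
    calc u ^ 2 = u * u := sq u
      _ ≤ -a * -b := mul_le_mul hua hub hu0 (hu0.trans hua)
      _ = a * b := neg_mul_neg a b
  have habc : u ^ 2 * (w ^ 2 / 2 - 1) ≤ a * b * -c :=
    mul_le_mul hab (by linarith) (by linarith) ((sq_nonneg u).trans hab)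
  have hsc : s ^ 2 * (w ^ 2 / 2 - 1) ^ 2 ≤ s ^ 2 * c ^ 2 := by gcongr
  have hpa : p ^ 2 * u ^ 2 ≤ p ^ 2 * a ^ 2 := by gcongr
  have hqb : q ^ 2 * u ^ 2 ≤ q ^ 2 * b ^ 2 := by gcongr
  have hTu : w ^ 2 / 2 * u ^ 2 ≤ (p ^ 2 + q ^ 2) * u ^ 2 := by gcongr
  have key := large_radii_bound hu0 hw1 (by linarith) hw2
  have hs2 : s ^ 2 = (1 + u) / 2 := by linarith
  rw [hs2] at hsc ⊢
  linear_combination key + h1 + habc * 2 + hsc + hpa + hqb + hTu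

lemma vertexExcess_pos_of_sq_le {p q s a b c : ℝ} (hq : q ^ 2 < 1) (hs : s ^ 2 < 1)
    (ha : a ^ 2 < 1) (hb : b ^ 2 < 1) (hc : c ^ 2 < 1) (h : p ^ 2 ≤ b ^ 2 ∨ p ^ 2 ≤ c ^ 2) :
    0 < vertexExcess p q s a b c := by
  unfold vertexExcess unitGramDet
  have h2 := mul_pos (sub_pos.2 hb) (sub_pos.2 hq)
  have h3 := mul_pos (sub_pos.2 hc) (sub_pos.2 hs)
  rcases h with h | h
  · nlinarith [mul_nonneg (sub_pos.2 ha).le (sub_nonneg.2 h), sq_nonneg (c - a * b)]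
  · nlinarith [mul_nonneg (sub_pos.2 ha).le (sub_nonneg.2 h), sq_nonneg (b - a * c)]

theorem vertexExcess_pos {p q s a b c : ℝ} (hp0 : 0 < p) (hp : p < 1) (hq0 : 0 < q)
    (hq : q < 1) (hs0 : 0 < s) (hs : s < 1) (ha : a ^ 2 < 1) (hb : b ^ 2 < 1) (hc : c ^ 2 < 1)
    (hA : (q + s) ^ 2 ≤ 2 - 2 * a) (hB : (s + p) ^ 2 ≤ 2 - 2 * b)
    (hC : (p + q) ^ 2 ≤ 2 - 2 * c) :
    0 < vertexExcess p q s a b c := by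
  have hp2 : p ^ 2 < 1 := by nlinarith
  have hq2 : q ^ 2 < 1 := by nlinarith
  have hs2 : s ^ 2 < 1 := by nlinarith
  by_cases h1 : p ^ 2 ≤ b ^ 2 ∨ p ^ 2 ≤ c ^ 2
  · exact vertexExcess_pos_of_sq_le hq2 hs2 ha hb hc h1
  by_cases h2 : q ^ 2 ≤ c ^ 2 ∨ q ^ 2 ≤ a ^ 2
  · rw [← vertexExcess_rotate]
    exact vertexExcess_pos_of_sq_le hs2 hp2 hb hc ha h2
  by_cases h3 : s ^ 2 ≤ a ^ 2 ∨ s ^ 2 ≤ b ^ 2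
  · rw [← vertexExcess_rotate, ← vertexExcess_rotate]
    exact vertexExcess_pos_of_sq_le hp2 hq2 hc ha hb h3
  push Not at h1 h2 h3
  obtain ⟨hpb, hpc⟩ := h1
  obtain ⟨hqc, hqa⟩ := h2
  obtain ⟨hsa, hsb⟩ := h3
  by_cases hcs : s ^ 2 ≤ 1 / 2 ∧ c ≤ 0
  · exact vertexExcess_pos_of_small_of_obtuse hp0 hp hq0 hq hcs.1 hcs.2 hc.le hsa.le hsb.le hC
  by_cases hap : p ^ 2 ≤ 1 / 2 ∧ a ≤ 0
  · rw [← vertexExcess_rotate]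
    exact vertexExcess_pos_of_small_of_obtuse hq0 hq hs0 hs hap.1 hap.2 ha.le hpb.le hpc.le hA
  by_cases hbq : q ^ 2 ≤ 1 / 2 ∧ b ≤ 0
  · rw [← vertexExcess_rotate, ← vertexExcess_rotate]
    exact vertexExcess_pos_of_small_of_obtuse hs0 hs hp0 hp hbq.1 hbq.2 hb.le hqc.le hqa.le hB
  push Not at hcs hap hbq
  have hA' : (s + q) ^ 2 ≤ 2 - 2 * a := by rwa [add_comm]
  have hB' : (p + s) ^ 2 ≤ 2 - 2 * b := by rwa [add_comm]
  have hC' : (q + p) ^ 2 ≤ 2 - 2 * c := by rwa [add_comm]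
  have two_small_qs (h : q ^ 2 ≤ 1 / 2) (h' : s ^ 2 ≤ 1 / 2) : 0 < vertexExcess p q s a b c :=
    vertexExcess_pos_of_two_small hp0 hp hq0 hq hs0 h h' (hbq h) (hcs h') hqa.le hsa.le hpb.le
      hsb.le hpc.le hqc.le hA hB' hC
  have two_small_sp (h : s ^ 2 ≤ 1 / 2) (h' : p ^ 2 ≤ 1 / 2) :
      0 < vertexExcess p q s a b c := by
    rw [← vertexExcess_rotate]
    exact vertexExcess_pos_of_two_small hq0 hq hs0 hs hp0 h h' (hcs h) (hap h') hsb.le hpb.le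
      hqc.le hpc.le hqa.le hsa.le hB hC' hA
  have two_small_pq (h : p ^ 2 ≤ 1 / 2) (h' : q ^ 2 ≤ 1 / 2) :
      0 < vertexExcess p q s a b c := by
    rw [← vertexExcess_rotate, ← vertexExcess_rotate]
    exact vertexExcess_pos_of_two_small hs0 hs hp0 hp hq0 h h' (hap h) (hbq h') hpc.le hqc.le
      hsa.le hqa.le hsb.le hpb.le hC hA' hB
  have small_of_acute {x y d : ℝ} (hx : 0 < x) (hy : 0 < y) (hd : 0 < d)
      (h : (x + y) ^ 2 ≤ 2 - 2 * d) : x ^ 2 ≤ 1 / 2 ∨ y ^ 2 ≤ 1 / 2 := by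
    by_contra! hxy
    have : 1 / 2 < x * y := by
      apply lt_of_pow_lt_pow_left₀ 2 (by positivity)
      nlinarith
    nlinarith
  by_cases hp' : p ^ 2 ≤ 1 / 2
  · rcases small_of_acute hq0 hs0 (hap hp') hA with h | h
    exacts [two_small_pq hp' h, two_small_sp h hp']
  by_cases hq' : q ^ 2 ≤ 1 / 2
  · rcases small_of_acute hs0 hp0 (hbq hq') hB with h | h
    exacts [two_small_qs hq' h, absurd h hp']
  by_cases hs' : s ^ 2 ≤ 1 / 2
  · rcases small_of_acute hp0 hq0 (hcs hs') hC with h | h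
    exacts [absurd h hp', absurd h hq']
  push Not at hp' hq' hs'
  rcases le_total s p with hsp | hsp
  · rcases le_total s q with hsq | hsq
    · exact vertexExcess_pos_of_large hp hq hs0 hs'.le hsp hsq hA hB' hC
    · rw [← vertexExcess_rotate, ← vertexExcess_rotate]
      exact vertexExcess_pos_of_large hs hp hq0 hq'.le hsq (hsq.trans hsp) hC hA' hB
  · rcases le_total p q with hpq | hpq
    · rw [← vertexExcess_rotate]
      exact vertexExcess_pos_of_large hq hs hp0 hp'.le hpq hsp hB hC' hA
    · rw [← vertexExcess_rotate, ← vertexExcess_rotate]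
      exact vertexExcess_pos_of_large hs hp hq0 hq'.le (hpq.trans hsp) hpq hC hA' hB

open scoped InnerProductSpace in
/-- A line through the origin avoids a ball centered on the unit sphere as soon as its direction
makes a large enough angle with the center. -/
lemma smul_notMem_closedBall {E : Type*} [NormedAddCommGroup E] [InnerProductSpace ℝ E]
    {x v : E} {ρ : ℝ} (hx : ‖x‖ = 1)
    (h : ⟪x, v⟫_ℝ ^ 2 < (1 - ρ ^ 2) * ‖v‖ ^ 2) (t : ℝ) : t • v ∉ Metric.closedBall x ρ := by
  rw [Metric.mem_closedBall, dist_eq_norm, not_le]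
  apply lt_of_pow_lt_pow_left₀ 2 (norm_nonneg _)
  rw [norm_sub_sq_real, norm_smul, mul_pow, Real.norm_eq_abs, sq_abs, hx, real_inner_smul_left,
    real_inner_comm]
  have hv : 0 < ‖v‖ ^ 2 := by
    rcases (sq_nonneg ‖v‖).eq_or_lt with h0 | h0
    · rw [← h0] at h
      nlinarith [sq_nonneg ⟪x, v⟫_ℝ]
    · exact h0
  have key : 0 < ‖v‖ ^ 2 * (t ^ 2 * ‖v‖ ^ 2 - 2 * (t * ⟪x, v⟫_ℝ) + 1 ^ 2 - ρ ^ 2) := by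
    nlinarith [sq_nonneg (t * ‖v‖ ^ 2 - ⟪x, v⟫_ℝ)]
  linarith [pos_of_mul_pos_right key hv.le]

lemma exists_ne_zero_inner_eq_zero {n : ℕ} {c : Fin n → EuclideanSpace ℝ (Fin n)}
    (h : ¬ LinearIndependent ℝ c) :
    ∃ v : EuclideanSpace ℝ (Fin n), v ≠ 0 ∧ ∀ i, inner ℝ (c i) v = 0 := by
  have hspan : Submodule.span ℝ (Set.range c) ≠ ⊤ := fun htop =>
    h (linearIndependent_of_top_le_span_of_card_eq_finrank htop.ge (by simp))
  obtain ⟨v, hv, hv0⟩ := Submodule.exists_mem_ne_zero_of_ne_bot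
    (mt Submodule.orthogonal_eq_bot_iff.1 hspan)
  exact ⟨v, hv0, fun i => hv _ (Submodule.subset_span ⟨i, rfl⟩)⟩

open scoped InnerProductSpace in
/-- If the four vertices, up to sign, of a parallelepiped have mean square norm above a bound, so
does one of them. -/
lemma exists_signs_lt_norm_sq {E : Type*} [NormedAddCommGroup E] [InnerProductSpace ℝ E]
    (x y z : E) {d : ℝ} (h : d < ‖x‖ ^ 2 + ‖y‖ ^ 2 + ‖z‖ ^ 2) :
    ∃ ε δ : ℝ, ε ^ 2 = 1 ∧ δ ^ 2 = 1 ∧ d < ‖x + ε • y + δ • z‖ ^ 2 := by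
  by_contra! hle
  have h1 := hle 1 1 (by norm_num) (by norm_num)
  have h2 := hle 1 (-1) (by norm_num) (by norm_num)
  have h3 := hle (-1) 1 (by norm_num) (by norm_num)
  have h4 := hle (-1) (-1) (by norm_num) (by norm_num)
  simp only [norm_add_sq_real, inner_add_left, real_inner_smul_left, real_inner_smul_right,
    norm_smul, norm_neg, norm_one, one_mul] at h1 h2 h3 h4
  linarith

open scoped InnerProductSpace in
/-- The vector of the (unnormalized) dual basis of unit vectors `x`, `y`, `z` dual to `x`. -/
def unitDual {E : Type*} [NormedAddCommGroup E] [InnerProductSpace ℝ E] (x y z : E) : E :=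
  (1 - ⟪y, z⟫_ℝ ^ 2) • x + (⟪y, z⟫_ℝ * ⟪z, x⟫_ℝ - ⟪x, y⟫_ℝ) • y
    + (⟪y, z⟫_ℝ * ⟪x, y⟫_ℝ - ⟪z, x⟫_ℝ) • z

section UnitDual

open scoped InnerProductSpace

variable {E : Type*} [NormedAddCommGroup E] [InnerProductSpace ℝ E] {x y z : E}

lemma inner_unitDual_self (hx : ‖x‖ = 1) :
    ⟪x, unitDual x y z⟫_ℝ = unitGramDet ⟪y, z⟫_ℝ ⟪z, x⟫_ℝ ⟪x, y⟫_ℝ := by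
  simp only [unitDual, unitGramDet, inner_add_right, real_inner_smul_right,
    real_inner_self_eq_norm_sq, hx, real_inner_comm z x]
  ring

lemma inner_unitDual_left (hy : ‖y‖ = 1) : ⟪y, unitDual x y z⟫_ℝ = 0 := by
  simp only [unitDual, inner_add_right, real_inner_smul_right,
    real_inner_self_eq_norm_sq, hy, real_inner_comm x y]
  ring

lemma inner_unitDual_right (hz : ‖z‖ = 1) : ⟪z, unitDual x y z⟫_ℝ = 0 := by
  simp only [unitDual, inner_add_right, real_inner_smul_right,
    real_inner_self_eq_norm_sq, hz, real_inner_comm y z]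
  ring

lemma norm_unitDual_sq (hx : ‖x‖ = 1) (hy : ‖y‖ = 1) (hz : ‖z‖ = 1) :
    ‖unitDual x y z‖ ^ 2
      = (1 - ⟪y, z⟫_ℝ ^ 2) * unitGramDet ⟪y, z⟫_ℝ ⟪z, x⟫_ℝ ⟪x, y⟫_ℝ := by
  rw [← real_inner_self_eq_norm_sq]
  nth_rewrite 1 [unitDual]
  simp only [inner_add_left, real_inner_smul_left, inner_unitDual_self hx,
    inner_unitDual_left hy, inner_unitDual_right hz]
  ring

end UnitDual

lemma unitGramDet_rotate (a b c : ℝ) : unitGramDet b c a = unitGramDet a b c := by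
  unfold unitGramDet
  ring

lemma sq_lt_one_of_unitGramDet_pos {a b c : ℝ} (ha : a ^ 2 ≤ 1) (h : 0 < unitGramDet a b c) :
    a ^ 2 < 1 := by
  refine lt_of_le_of_ne ha fun ha1 => ?_
  unfold unitGramDet at h
  nlinarith [sq_nonneg (c - a * b)]

lemma inner_sq_le_one {E : Type*} [NormedAddCommGroup E] [InnerProductSpace ℝ E] {x y : E}
    (hx : ‖x‖ = 1) (hy : ‖y‖ = 1) : inner ℝ x y ^ 2 ≤ 1 := by
  rw [sq_le_one_iff_abs_le_one]
  simpa [hx, hy] using abs_real_inner_le_norm x y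

lemma unitGramDet_pos {E : Type*} [NormedAddCommGroup E] [InnerProductSpace ℝ E]
    {c : Fin 3 → E} (hc : ∀ i, ‖c i‖ = 1) (h : LinearIndependent ℝ c) :
    0 < unitGramDet (inner ℝ (c 1) (c 2)) (inner ℝ (c 2) (c 0)) (inner ℝ (c 0) (c 1)) := by
  have hdet := (Matrix.posDef_gram_of_linearIndependent h).det_pos
  simp only [Matrix.det_fin_three, Matrix.gram_apply, real_inner_self_eq_norm_sq, hc,
    real_inner_comm (c 0) (c 1), real_inner_comm (c 1) (c 2), real_inner_comm (c 2) (c 0)]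
    at hdet
  unfold unitGramDet
  linarith

lemma add_sq_le_of_disjoint_closedBall {E : Type*} [NormedAddCommGroup E]
    [InnerProductSpace ℝ E] {x y : E} {ρ σ : ℝ} (hx : ‖x‖ = 1) (hy : ‖y‖ = 1) (hρ : 0 ≤ ρ)
    (hσ : 0 ≤ σ) (h : Disjoint (Metric.closedBall x ρ) (Metric.closedBall y σ)) :
    (ρ + σ) ^ 2 ≤ 2 - 2 * inner ℝ x y := by
  rw [disjoint_closedBall_closedBall_iff hρ hσ, dist_eq_norm] at h
  have := pow_le_pow_left₀ (add_nonneg hρ hσ) h.le 2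
  rw [norm_sub_sq_real, hx, hy] at this
  linarith

/-- Three pairwise disjoint closed balls in `ℝ³` with centers on the unit sphere and radii
in `(0,1)` never block every line through the origin. -/
theorem three_balls_insufficient
    (c : Fin 3 → EuclideanSpace ℝ (Fin 3)) (r : Fin 3 → ℝ)
    (hc : ∀ i, ‖c i‖ = 1) (hr0 : ∀ i, 0 < r i) (hr1 : ∀ i, r i < 1)
    (hdisj : Pairwise fun i j => Disjoint (Metric.closedBall (c i) (r i))
      (Metric.closedBall (c j) (r j))) :
    ∃ v : EuclideanSpace ℝ (Fin 3), v ≠ 0 ∧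
      ∀ (t : ℝ) (i : Fin 3), t • v ∉ Metric.closedBall (c i) (r i) := by
  have hrad (i) : 0 < 1 - r i ^ 2 := by nlinarith [hr0 i, hr1 i]
  by_cases hli : LinearIndependent ℝ c
  swap
  · obtain ⟨v, hv0, hv⟩ := exists_ne_zero_inner_eq_zero hli
    refine ⟨v, hv0, fun t i => smul_notMem_closedBall (hc i) ?_ t⟩
    rw [hv i]
    have := mul_pos (hrad i) (pow_pos (norm_pos_iff.2 hv0) 2)
    simpa using this
  have hsep {i j : Fin 3} (hij : i ≠ j) :=
    add_sq_le_of_disjoint_closedBall (hc i) (hc j) (hr0 i).le (hr0 j).le (hdisj hij)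
  have hD := unitGramDet_pos hc hli
  have hinner (i j) := inner_sq_le_one (hc i) (hc j)
  have hexc := vertexExcess_pos (hr0 0) (hr1 0) (hr0 1) (hr1 1) (hr0 2) (hr1 2)
    (sq_lt_one_of_unitGramDet_pos (hinner 1 2) hD)
    (sq_lt_one_of_unitGramDet_pos (hinner 2 0) (by rwa [unitGramDet_rotate]))
    (sq_lt_one_of_unitGramDet_pos (hinner 0 1)
      (by rwa [unitGramDet_rotate, unitGramDet_rotate]))
    (hsep (by decide)) (hsep (by decide)) (hsep (by decide))
  have hn0 := norm_unitDual_sq (hc 0) (hc 1) (hc 2)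
  have hn1 := norm_unitDual_sq (hc 1) (hc 2) (hc 0)
  have hn2 := norm_unitDual_sq (hc 2) (hc 0) (hc 1)
  have hi0 := inner_unitDual_self (y := c 1) (z := c 2) (hc 0)
  have hi1 := inner_unitDual_self (y := c 2) (z := c 0) (hc 1)
  have hi2 := inner_unitDual_self (y := c 0) (z := c 1) (hc 2)
  rw [unitGramDet_rotate] at hn1 hi1
  rw [unitGramDet_rotate, unitGramDet_rotate] at hn2 hi2
  unfold vertexExcess at hexc
  set D := unitGramDet (inner ℝ (c 1) (c 2)) (inner ℝ (c 2) (c 0)) (inner ℝ (c 0) (c 1))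
  have hh (i) : √(1 - r i ^ 2) ^ 2 = 1 - r i ^ 2 := Real.sq_sqrt (hrad i).le
  obtain ⟨ε, δ, hε, hδ, hw⟩ := exists_signs_lt_norm_sq (d := D ^ 2)
    (√(1 - r 0 ^ 2) • unitDual (c 0) (c 1) (c 2)) (√(1 - r 1 ^ 2) • unitDual (c 1) (c 2) (c 0))
    (√(1 - r 2 ^ 2) • unitDual (c 2) (c 0) (c 1)) (by
      simp only [norm_smul, mul_pow, Real.norm_eq_abs, sq_abs, hh, hn0, hn1, hn2]
      nlinarith)
  set w := √(1 - r 0 ^ 2) • unitDual (c 0) (c 1) (c 2)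
    + ε • √(1 - r 1 ^ 2) • unitDual (c 1) (c 2) (c 0)
    + δ • √(1 - r 2 ^ 2) • unitDual (c 2) (c 0) (c 1) with hwdef
  have hwi (i) : inner ℝ (c i) w ^ 2 = (1 - r i ^ 2) * D ^ 2 := by
    fin_cases i <;>
    simp [hwdef, inner_add_right, real_inner_smul_right, inner_unitDual_left,
      inner_unitDual_right, hc, hi0, hi1, hi2, mul_pow, hε, hδ, hh]
  refine ⟨w, ?_, fun t i => smul_notMem_closedBall (hc i) ?_ t⟩
  · rintro h0
    rw [h0, norm_zero] at hw
    nlinarith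
  · rw [hwi]
    exact mul_lt_mul_of_pos_left hw (hrad i)
end

section
/- Let n ≥ 3 and let B₁, …, Bₙ be n pairwise disjoint closed balls in n-dimensional Euclidean space ℝⁿ, whose centers lie on the unit sphere S^{n−1} (have norm 1) and whose radii are positive and strictly less than 1. Then there exists a line through the origin that is disjoint from B₁ ∪ … ∪ Bₙ. In other words, for n ≥ 3 the minimal number of such balls that can block every line through the center of the sphere is n+1. -/
open scoped RealInnerProductSpace

section RealInequalities

/-- The centers of two separated balls of large radii `u`, `v` have negative inner product `x`,
bounded away from zero. -/
lemma one_sub_sq_le_of_add_sq_lt {u v x : ℝ} (huv : 1 / 2 < u * v)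
    (h : (u + v) ^ 2 < 2 - 2 * x) : x < 0 ∧ 1 - x ^ 2 ≤ 4 * (u * v) * (1 - u * v) := by
  have hx : x < 1 - 2 * (u * v) := by nlinarith [sq_nonneg (u - v)]
  exact ⟨by linarith, by nlinarith⟩

/-- For two balls of radii `u`, `v` that are separated, with inner product of centers `x`, the
quantity `2 - u ^ 2 - v ^ 2` is large compared with `1 - x ^ 2`. -/
lemma mul_one_sub_sq_lt_of_add_sq_lt {u v w x : ℝ} (hu0 : 0 < u) (hv0 : 0 < v) (hu : u < 1)
    (hv : v < 1) (hw : w ^ 2 ≤ 1 / 2) (h : (u + v) ^ 2 < 2 - 2 * x) :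
    w ^ 2 * (1 - x ^ 2) < 2 - u ^ 2 - v ^ 2 := by
  by_contra! hle
  have hsq : 3 / 2 ≤ u ^ 2 + v ^ 2 := by nlinarith [sq_nonneg x, sq_nonneg w]
  have huv : 1 / 2 ≤ u * v := by
    refine le_of_sq_le_sq (?_ : (1 / 2 : ℝ) ^ 2 ≤ (u * v) ^ 2) (by positivity)
    nlinarith [mul_nonneg (by nlinarith : 0 ≤ 1 - u ^ 2) (by nlinarith : 0 ≤ 1 - v ^ 2)]
  obtain ⟨s, hs⟩ : ∃ s, s = u + v := ⟨_, rfl⟩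
  rw [← hs] at h
  have hs0 : 0 < s := by linarith
  have hs2 : s < 2 := by linarith
  have hss : 2 ≤ s ^ 2 := by rw [hs]; nlinarith
  have hx : 1 - x ^ 2 ≤ s ^ 2 * (4 - s ^ 2) / 4 := by nlinarith
  have hlow : s * (2 - s) ≤ 2 - u ^ 2 - v ^ 2 := by
    rw [hs]; nlinarith [mul_pos (sub_pos.2 hu) (sub_pos.2 hv)]
  have hx' : w ^ 2 * (1 - x ^ 2) ≤ 1 / 2 * (s ^ 2 * (4 - s ^ 2) / 4) :=
    calc w ^ 2 * (1 - x ^ 2) ≤ w ^ 2 * (s ^ 2 * (4 - s ^ 2) / 4) := by gcongr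
      _ ≤ 1 / 2 * (s ^ 2 * (4 - s ^ 2) / 4) := by
        gcongr
        have : 0 ≤ 4 - s ^ 2 := by nlinarith
        positivity
  have hpos : 0 < s * (2 - s) := mul_pos hs0 (by linarith)
  have hfac : s * (2 + s) < 8 := by nlinarith
  nlinarith [mul_pos hpos (sub_pos.2 hfac)]

/-- The Gram determinant of the centers of three separated balls with large radii is small. -/
lemma gram_det_lt_of_half_lt_sq {r₁ r₂ r₃ x y z : ℝ} (h₁ : 0 < r₁) (h₂ : 0 < r₂) (h₃ : 0 < r₃)
    (h₁' : r₁ < 1) (h₂' : r₂ < 1) (h₃' : r₃ < 1)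
    (hr₁ : 1 / 2 < r₁ ^ 2) (hr₂ : 1 / 2 < r₂ ^ 2) (hr₃ : 1 / 2 < r₃ ^ 2)
    (hx : (r₂ + r₃) ^ 2 < 2 - 2 * x) (hy : (r₁ + r₃) ^ 2 < 2 - 2 * y)
    (hz : (r₁ + r₂) ^ 2 < 2 - 2 * z) :
    1 + 2 * x * y * z - x ^ 2 - y ^ 2 - z ^ 2 <
      (1 - r₁ ^ 2) * (1 - x ^ 2) + (1 - r₂ ^ 2) * (1 - y ^ 2) + (1 - r₃ ^ 2) * (1 - z ^ 2) := by
  have half_lt {u v : ℝ} (hu : 0 < u) (hv : 0 < v) (hu2 : 1 / 2 < u ^ 2) (hv2 : 1 / 2 < v ^ 2) :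
      1 / 2 < u * v := by
    refine lt_of_pow_lt_pow_left₀ 2 (by positivity) ?_
    nlinarith
  obtain ⟨hx0, hx2⟩ := one_sub_sq_le_of_add_sq_lt (half_lt h₂ h₃ hr₂ hr₃) hx
  obtain ⟨hy0, hy2⟩ := one_sub_sq_le_of_add_sq_lt (half_lt h₁ h₃ hr₁ hr₃) hy
  obtain ⟨hz0, hz2⟩ := one_sub_sq_le_of_add_sq_lt (half_lt h₁ h₂ hr₁ hr₂) hz
  have hxyz : x * y * z < 0 := mul_neg_of_pos_of_neg (mul_pos_of_neg_of_neg hx0 hy0) hz0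
  have e₁ := mul_le_mul_of_nonneg_left hx2 (sq_nonneg r₁)
  have e₂ := mul_le_mul_of_nonneg_left hy2 (sq_nonneg r₂)
  have e₃ := mul_le_mul_of_nonneg_left hz2 (sq_nonneg r₃)
  have hP : 0 < r₁ * r₂ * r₃ := by positivity
  have hS : r₁ + r₂ + r₃ - 2 < r₁ * r₂ * r₃ := by
    nlinarith [mul_pos (sub_pos.2 h₁') (sub_pos.2 h₂'),
      mul_pos (sub_pos.2 (mul_lt_one_of_nonneg_of_lt_one_left h₁.le h₁' h₂'.le)) (sub_pos.2 h₃')]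
  have hPS : 4 * (r₁ * r₂ * r₃) * (r₁ + r₂ + r₃ - 3 * (r₁ * r₂ * r₃)) < 2 := by
    nlinarith [mul_pos hP (sub_pos.2 hS), sq_nonneg (2 * (r₁ * r₂ * r₃) - 1)]
  nlinarith

end RealInequalities

section InnerProduct

variable {E : Type*} [NormedAddCommGroup E] [InnerProductSpace ℝ E]

/-- Signs can be chosen so that a signed sum of vectors is at least as long as for orthogonal
vectors. -/
lemma exists_signs_sum_norm_sq_le {ι : Type*} (s : Finset ι) (f : ι → E) :
    ∃ ε : ι → ℝ, (∀ i, ε i ^ 2 = 1) ∧ ∑ i ∈ s, ‖f i‖ ^ 2 ≤ ‖∑ i ∈ s, ε i • f i‖ ^ 2 := by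
  classical
  induction s using Finset.induction_on with
  | empty => exact ⟨fun _ => 1, by simp, by simp⟩
  | insert a s ha ih =>
    obtain ⟨ε, hε, hle⟩ := ih
    obtain ⟨δ, hδ, hδ0⟩ : ∃ δ : ℝ, δ ^ 2 = 1 ∧ 0 ≤ δ * ⟪f a, ∑ i ∈ s, ε i • f i⟫ := by
      rcases le_total 0 ⟪f a, ∑ i ∈ s, ε i • f i⟫ with h | h
      · exact ⟨1, by simp, by simpa using h⟩
      · exact ⟨-1, by simp, by simpa using h⟩
    refine ⟨Function.update ε a δ, fun i => ?_, ?_⟩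
    · rcases eq_or_ne i a with rfl | hi
      · simpa using hδ
      · simpa [hi] using hε i
    · have hsum : ∑ i ∈ s, Function.update ε a δ i • f i = ∑ i ∈ s, ε i • f i :=
        Finset.sum_congr rfl fun i hi => by
          rw [Function.update_of_ne (ne_of_mem_of_not_mem hi ha)]
      rw [Finset.sum_insert ha, Finset.sum_insert ha, hsum, Function.update_self,
        norm_add_sq_real, norm_smul, mul_pow, Real.norm_eq_abs, sq_abs, hδ, real_inner_smul_left]
      linarith

/-- A vector dual to the unit vector `a` relative to the unit vector `b` is long. -/
lemma one_le_norm_sq_mul_one_sub_inner_sq {a b d : E} (ha : ‖a‖ = 1) (hb : ‖b‖ = 1)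
    (hda : ⟪a, d⟫ = 1) (hdb : ⟪b, d⟫ = 0) : 1 ≤ ‖d‖ ^ 2 * (1 - ⟪a, b⟫ ^ 2) := by
  have h := real_inner_mul_inner_self_le (a - ⟪a, b⟫ • b) d
  simp only [inner_sub_left, inner_sub_right, real_inner_smul_left, real_inner_smul_right, hda,
    hdb, real_inner_self_eq_norm_sq, norm_smul, mul_pow, Real.norm_eq_abs, sq_abs, ha, hb,
    real_inner_comm a b] at h
  linarith

/-- A vector dual to the unit vector `a` relative to the unit vectors `b`, `c` is long. -/
lemma one_sub_inner_sq_le_norm_sq_mul_gram_det {a b c d : E} (ha : ‖a‖ = 1) (hb : ‖b‖ = 1)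
    (hc : ‖c‖ = 1) (hda : ⟪a, d⟫ = 1) (hdb : ⟪b, d⟫ = 0) (hdc : ⟪c, d⟫ = 0)
    (hbc : 0 < 1 - ⟪b, c⟫ ^ 2) :
    1 - ⟪b, c⟫ ^ 2 ≤ ‖d‖ ^ 2 *
      (1 + 2 * ⟪b, c⟫ * ⟪a, c⟫ * ⟪a, b⟫ - ⟪b, c⟫ ^ 2 - ⟪a, c⟫ ^ 2 - ⟪a, b⟫ ^ 2) := by
  have h := real_inner_mul_inner_self_le
    ((1 - ⟪b, c⟫ ^ 2) • a - (⟪a, b⟫ - ⟪b, c⟫ * ⟪a, c⟫) • b - (⟪a, c⟫ - ⟪b, c⟫ * ⟪a, b⟫) • c) d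
  simp only [inner_sub_left, inner_sub_right, real_inner_smul_left, real_inner_smul_right, hda,
    hdb, hdc, real_inner_self_eq_norm_sq, norm_smul, mul_pow, Real.norm_eq_abs, sq_abs, ha, hb, hc,
    real_inner_comm a b, real_inner_comm a c, real_inner_comm b c] at h
  refine le_of_mul_le_mul_left ?_ hbc
  linarith

/-- Three separated balls with centers on the unit sphere: any system dual to the centers
has large weighted square length. -/
lemma one_lt_sum_mul_norm_sq_of_dual {c d : Fin 3 → E} {r : Fin 3 → ℝ} (hc : ∀ i, ‖c i‖ = 1)
    (hr0 : ∀ i, 0 < r i) (hr1 : ∀ i, r i < 1)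
    (hsep : ∀ i j, i ≠ j → (r i + r j) ^ 2 < 2 - 2 * ⟪c i, c j⟫)
    (hself : ∀ i, ⟪c i, d i⟫ = 1) (hdual : ∀ i j, i ≠ j → ⟪c i, d j⟫ = 0) :
    1 < ∑ i, (1 - r i ^ 2) * ‖d i‖ ^ 2 := by
  have hs (i) : 0 < 1 - r i ^ 2 := by nlinarith [hr0 i, hr1 i]
  have hpair (i j) (hij : i ≠ j) : 1 ≤ ‖d i‖ ^ 2 * (1 - ⟪c i, c j⟫ ^ 2) :=
    one_le_norm_sq_mul_one_sub_inner_sq (hc i) (hc j) (hself i) (hdual j i hij.symm)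
  have hpos (i j) (hij : i ≠ j) : 0 < 1 - ⟪c i, c j⟫ ^ 2 :=
    pos_of_mul_pos_right (zero_lt_one.trans_le (hpair i j hij)) (by positivity)
  have hone (i) : 1 ≤ ‖d i‖ ^ 2 := by
    have h := real_inner_mul_inner_self_le (c i) (d i)
    simpa [hself, hc, real_inner_self_eq_norm_sq] using h
  by_contra! hle
  have hsmall (i j k) (hij : i ≠ j) (hik : i ≠ k) (hjk : j ≠ k)
      (hk : (1 - r i ^ 2) * ‖d i‖ ^ 2 + (1 - r j ^ 2) * ‖d j‖ ^ 2 + (1 - r k ^ 2) * ‖d k‖ ^ 2 ≤ 1) :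
      1 / 2 < r k ^ 2 := by
    by_contra! hk2
    have h := mul_one_sub_sq_lt_of_add_sq_lt (hr0 i) (hr0 j) (hr1 i) (hr1 j) hk2 (hsep i j hij)
    have hi := mul_le_mul_of_nonneg_left (hpair i j hij) (hs i).le
    have hj := mul_le_mul_of_nonneg_left (hpair j i hij.symm) (hs j).le
    rw [real_inner_comm] at hj
    have hk1 := mul_le_mul_of_nonneg_left (hone k) (hs k).le
    nlinarith [mul_le_mul_of_nonneg_right (hk.trans' (add_le_add_right hk1 _)) (hpos i j hij).le]
  rw [Fin.sum_univ_three] at hle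
  have hr2 := hsmall 0 1 2 (by decide) (by decide) (by decide) hle
  have hr1' := hsmall 0 2 1 (by decide) (by decide) (by decide) (by linarith)
  have hr0' := hsmall 1 2 0 (by decide) (by decide) (by decide) (by linarith)
  have hdet := gram_det_lt_of_half_lt_sq (hr0 0) (hr0 1) (hr0 2) (hr1 0) (hr1 1) (hr1 2)
    hr0' hr1' hr2 (hsep 1 2 (by decide)) (hsep 0 2 (by decide)) (hsep 0 1 (by decide))
  have h0 := one_sub_inner_sq_le_norm_sq_mul_gram_det (hc 0) (hc 1) (hc 2) (hself 0)
    (hdual 1 0 (by decide)) (hdual 2 0 (by decide)) (hpos 1 2 (by decide))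
  have h1 := one_sub_inner_sq_le_norm_sq_mul_gram_det (hc 1) (hc 0) (hc 2) (hself 1)
    (hdual 0 1 (by decide)) (hdual 2 1 (by decide)) (hpos 0 2 (by decide))
  have h2 := one_sub_inner_sq_le_norm_sq_mul_gram_det (hc 2) (hc 0) (hc 1) (hself 2)
    (hdual 0 2 (by decide)) (hdual 1 2 (by decide)) (hpos 0 1 (by decide))
  rw [real_inner_comm (c 0) (c 1)] at h1
  rw [real_inner_comm (c 0) (c 2), real_inner_comm (c 1) (c 2)] at h2
  generalize hD : 1 + 2 * ⟪c 1, c 2⟫ * ⟪c 0, c 2⟫ * ⟪c 0, c 1⟫ - ⟪c 1, c 2⟫ ^ 2 - ⟪c 0, c 2⟫ ^ 2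
    - ⟪c 0, c 1⟫ ^ 2 = D at hdet h0
  have hD0 : 0 ≤ D :=
    (pos_of_mul_pos_right ((hpos 1 2 (by decide)).trans_le h0) (by positivity)).le
  have h1' : 1 - ⟪c 0, c 2⟫ ^ 2 ≤ ‖d 1‖ ^ 2 * D := by rw [← hD]; linarith
  have h2' : 1 - ⟪c 0, c 1⟫ ^ 2 ≤ ‖d 2‖ ^ 2 * D := by rw [← hD]; linarith
  have e0 := mul_le_mul_of_nonneg_left h0 (hs 0).le
  have e1 := mul_le_mul_of_nonneg_left h1' (hs 1).le
  have e2 := mul_le_mul_of_nonneg_left h2' (hs 2).le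
  have := mul_le_mul_of_nonneg_right hle hD0
  linarith

/-- The line spanned by `v` misses the ball of radius `r < 1` around the unit vector `c` if `v` is
orthogonal to `c`, or if `v` has norm greater than one and `⟪c, v⟫ ^ 2 = 1 - r ^ 2`. -/
lemma smul_notMem_closedBall_s7 {c v : E} {r : ℝ} (hc : ‖c‖ = 1) (hr0 : 0 < r) (hr1 : r < 1)
    (hv : ⟪c, v⟫ = 0 ∨ 1 < ‖v‖ ^ 2 ∧ ⟪c, v⟫ ^ 2 = 1 - r ^ 2) (t : ℝ) :
    t • v ∉ Metric.closedBall c r := by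
  intro hmem
  rw [Metric.mem_closedBall, dist_eq_norm] at hmem
  have hsq : ‖t • v - c‖ ^ 2 ≤ r ^ 2 := by gcongr
  rw [norm_sub_sq_real, norm_smul, mul_pow, Real.norm_eq_abs, sq_abs, hc, real_inner_smul_left,
    real_inner_comm] at hsq
  have hs : 0 < 1 - r ^ 2 := by nlinarith
  rcases hv with hv | ⟨hv, he⟩
  · rw [hv] at hsq
    nlinarith [mul_nonneg (sq_nonneg t) (sq_nonneg ‖v‖)]
  · rcases eq_or_ne t 0 with rfl | ht
    · linarith
    · have ht2 : 0 < t ^ 2 := by positivity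
      nlinarith [mul_pos ht2 (sub_pos.2 hv), sq_nonneg (t - ⟪c, v⟫)]

end InnerProduct

/-- For `n ≥ 3`, `n` pairwise disjoint closed balls in `ℝⁿ` with centers on the unit sphere
and radii in `(0,1)` never block every line through the origin. -/
theorem n_balls_insufficient (n : ℕ) (hn : 3 ≤ n)
    (c : Fin n → EuclideanSpace ℝ (Fin n)) (r : Fin n → ℝ)
    (hc : ∀ i, ‖c i‖ = 1) (hr0 : ∀ i, 0 < r i) (hr1 : ∀ i, r i < 1)
    (hdisj : Pairwise fun i j => Disjoint (Metric.closedBall (c i) (r i))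
      (Metric.closedBall (c j) (r j))) :
    ∃ v : EuclideanSpace ℝ (Fin n), v ≠ 0 ∧
      ∀ (t : ℝ) (i : Fin n), t • v ∉ Metric.closedBall (c i) (r i) := by
  let L : EuclideanSpace ℝ (Fin n) →ₗ[ℝ] (Fin n → ℝ) := LinearMap.pi fun i => innerₗ _ (c i)
  have hL (v i) : L v i = ⟪c i, v⟫ := rfl
  by_cases hinj : Function.Injective L
  swap
  · obtain ⟨v, hv, hv0⟩ : ∃ v, L v = 0 ∧ v ≠ 0 := by
      simpa [injective_iff_map_eq_zero] using hinj
    exact ⟨v, hv0, fun t i => smul_notMem_closedBall_s7 (hc i) (hr0 i) (hr1 i)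
      (Or.inl (congrFun hv i)) t⟩
  have hsurj : Function.Surjective L :=
    (LinearMap.injective_iff_surjective_of_finrank_eq_finrank (by simp)).1 hinj
  choose d hd using fun j : Fin n => hsurj (Pi.single j 1)
  have hdual (i j) : ⟪c i, d j⟫ = (Pi.single j 1 : Fin n → ℝ) i := by rw [← hL, hd]
  have hs (i) : 0 < 1 - r i ^ 2 := by nlinarith [hr0 i, hr1 i]
  obtain ⟨ε, hε, hle⟩ := exists_signs_sum_norm_sq_le Finset.univ fun i => √(1 - r i ^ 2) • d i
  have hsep (i j) (hij : i ≠ j) : (r i + r j) ^ 2 < 2 - 2 * ⟪c i, c j⟫ := by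
    have h := hdisj hij
    simp only [disjoint_closedBall_closedBall_iff (hr0 i).le (hr0 j).le, dist_eq_norm] at h
    have h2 : (r i + r j) ^ 2 < ‖c i - c j‖ ^ 2 := by
      have := hr0 i
      have := hr0 j
      gcongr
    rw [norm_sub_sq_real, hc, hc] at h2
    linarith
  have hnorm (i) : ‖√(1 - r i ^ 2) • d i‖ ^ 2 = (1 - r i ^ 2) * ‖d i‖ ^ 2 := by
    rw [norm_smul, mul_pow, Real.norm_eq_abs, sq_abs, Real.sq_sqrt (hs i).le]
  have hinj3 := Fin.castLE_injective hn
  have hlarge : 1 < ∑ i, (1 - r i ^ 2) * ‖d i‖ ^ 2 := by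
    refine (one_lt_sum_mul_norm_sq_of_dual (c := c ∘ Fin.castLE hn) (d := d ∘ Fin.castLE hn)
      (r := r ∘ Fin.castLE hn) (fun i => hc _) (fun i => hr0 _) (fun i => hr1 _)
      (fun i j hij => hsep _ _ (hinj3.ne hij)) (fun i => by simp [hdual])
      (fun i j hij => by simp [hdual, hij])).trans_le ?_
    have := Finset.sum_le_univ_sum_of_nonneg (s := Finset.univ.map ⟨_, hinj3⟩)
      (f := fun i => (1 - r i ^ 2) * ‖d i‖ ^ 2)
      fun i => mul_nonneg (hs i).le (sq_nonneg _)
    simpa using this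
  simp only [hnorm] at hle
  refine ⟨_, ?_, fun t i => smul_notMem_closedBall_s7 (hc i) (hr0 i) (hr1 i)
    (Or.inr ⟨hlarge.trans_le hle, ?_⟩) t⟩
  · intro h0
    rw [h0, norm_zero] at hle
    norm_num at hle
    linarith
  · simp [inner_sum, real_inner_smul_right, hdual, Pi.single_apply, mul_pow, hε,
      Real.sq_sqrt (hs i).le]
end

section
/- Let n ≥ 2 and let B₁, …, B_{n−1} be n−1 closed balls in n-dimensional Euclidean space ℝⁿ, none of which contains the origin. Then there exists a line through the origin that is disjoint from B₁ ∪ … ∪ B_{n−1}; in particular, n−1 balls never suffice to create a shadow at the center of the sphere. -/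
/-- Fewer than `dim E` vectors of `E` admit a common nonzero orthogonal vector. -/
theorem exists_ne_zero_forall_inner_eq_zero {E ι : Type*} [NormedAddCommGroup E]
    [InnerProductSpace ℝ E] [FiniteDimensional ℝ E] [Fintype ι]
    (h : Fintype.card ι < Module.finrank ℝ E) (c : ι → E) :
    ∃ v : E, v ≠ 0 ∧ ∀ i, inner ℝ (c i) v = 0 := by
  have hker : LinearMap.ker (LinearMap.pi fun i => (innerₛₗ ℝ (c i) : E →ₗ[ℝ] ℝ)) ≠ ⊥ :=
    LinearMap.ker_ne_bot_of_finrank_lt (by simpa using h)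
  obtain ⟨v, hv, hv0⟩ := Submodule.exists_mem_ne_zero_of_ne_bot hker
  exact ⟨v, hv0, fun i => congrFun (LinearMap.mem_ker.mp hv) i⟩

/-- The origin is a nearest point to `c` on any line through the origin orthogonal to `c`. -/
theorem norm_le_dist_smul_of_inner_eq_zero {E : Type*} [NormedAddCommGroup E]
    [InnerProductSpace ℝ E] {c v : E} (h : inner ℝ c v = 0) (t : ℝ) :
    ‖c‖ ≤ dist (t • v) c := by
  have hsq := norm_sub_sq_eq_norm_sq_add_norm_sq_real (x := c) (y := t • v)
    (by rw [inner_smul_right, h, mul_zero])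
  rw [dist_comm, dist_eq_norm]
  nlinarith [norm_nonneg c, norm_nonneg (c - t • v), mul_self_nonneg ‖t • v‖]

/-- For `n ≥ 2`, any `n-1` closed balls in `ℝⁿ` avoiding the origin fail to block every line
through the origin. -/
theorem n_sub_one_balls_insufficient (n : ℕ) (hn : 2 ≤ n)
    (c : Fin (n - 1) → EuclideanSpace ℝ (Fin n)) (r : Fin (n - 1) → ℝ)
    (h0 : ∀ i, (0 : EuclideanSpace ℝ (Fin n)) ∉ Metric.closedBall (c i) (r i)) :
    ∃ v : EuclideanSpace ℝ (Fin n), v ≠ 0 ∧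
      ∀ (t : ℝ) (i : Fin (n - 1)), t • v ∉ Metric.closedBall (c i) (r i) := by
  obtain ⟨v, hv0, hv⟩ := exists_ne_zero_forall_inner_eq_zero
    (by rw [Fintype.card_fin, finrank_euclideanSpace_fin]; omega) c
  refine ⟨v, hv0, fun t i hmem => h0 i ?_⟩
  rw [Metric.mem_closedBall, dist_zero_left]
  exact (norm_le_dist_smul_of_inner_eq_zero (hv i) t).trans hmem
end

section
/- There exist three pairwise disjoint closed discs in the Euclidean plane ℝ², whose centers lie on the unit circle (have norm 1) and whose radii are positive and strictly less than 1, such that every ray emanating from the origin intersects at least one of the discs. -/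
/-- If the direction `v` makes an angle at most `arcsin r` with the unit vector `c`, then the ray
from the origin through `v` meets the closed disc of radius `r` around `c`. -/
theorem exists_nonneg_smul_mem_closedBall {c v : EuclideanSpace ℝ (Fin 2)} {r k : ℝ}
    (hc : c 0 ^ 2 + c 1 ^ 2 = 1) (hr : 0 < r) (hrk : r ^ 2 + k ^ 2 = 1) (hv : v ≠ 0)
    (hpos : 0 ≤ r * (v 0 * c 0 + v 1 * c 1) + k * (v 0 * c 1 - v 1 * c 0))
    (hneg : 0 ≤ r * (v 0 * c 0 + v 1 * c 1) - k * (v 0 * c 1 - v 1 * c 0)) :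
    ∃ t : ℝ, 0 ≤ t ∧ t • v ∈ Metric.closedBall c r := by
  have hn : 0 < v 0 ^ 2 + v 1 ^ 2 := by
    have h := sq_pos_of_pos (norm_pos_iff.mpr hv)
    simpa [EuclideanSpace.norm_sq_eq, Fin.sum_univ_two] using h
  obtain ⟨d, hd⟩ : ∃ d, d = v 0 * c 0 + v 1 * c 1 := ⟨_, rfl⟩
  obtain ⟨e, he⟩ : ∃ e, e = v 0 * c 1 - v 1 * c 0 := ⟨_, rfl⟩
  rw [← hd, ← he] at hpos hneg
  have hd0 : 0 ≤ d := nonneg_of_mul_nonneg_right (by linarith) hr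
  have hde : d ^ 2 + e ^ 2 = v 0 ^ 2 + v 1 ^ 2 := by
    rw [hd, he]
    linear_combination (v 0 ^ 2 + v 1 ^ 2) * hc
  have hle : e ^ 2 ≤ r ^ 2 * (v 0 ^ 2 + v 1 ^ 2) := by
    rw [← hde]
    linear_combination mul_nonneg hpos hneg - e ^ 2 * hrk
  refine ⟨d / (v 0 ^ 2 + v 1 ^ 2), by positivity, ?_⟩
  rw [Metric.mem_closedBall, EuclideanSpace.dist_eq, Real.sqrt_le_left hr.le, Fin.sum_univ_two]
  simp only [Real.dist_eq, sq_abs, PiLp.smul_apply, smul_eq_mul]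
  have hdist : (d / (v 0 ^ 2 + v 1 ^ 2) * v 0 - c 0) ^ 2 +
      (d / (v 0 ^ 2 + v 1 ^ 2) * v 1 - c 1) ^ 2 = e ^ 2 / (v 0 ^ 2 + v 1 ^ 2) := by
    have hvv := hn.ne'
    field_simp
    rw [hd, he]
    ring
  rw [hdist, div_le_iff₀ hn]
  exact hle

/-- Discs in the plane are disjoint if the sum of the radii is less than the distance between the
centers. -/
theorem disjoint_closedBall_of_sq_lt {c c' : EuclideanSpace ℝ (Fin 2)} {r r' : ℝ}
    (hr : 0 ≤ r + r') (h : (r + r') ^ 2 < (c 0 - c' 0) ^ 2 + (c 1 - c' 1) ^ 2) :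
    Disjoint (Metric.closedBall c r) (Metric.closedBall c' r') := by
  apply Metric.closedBall_disjoint_closedBall
  rw [EuclideanSpace.dist_eq, Real.lt_sqrt hr, Fin.sum_univ_two]
  simpa only [Real.dist_eq, sq_abs] using h

/-- There exist three pairwise disjoint closed discs in the plane with centers on the unit
circle and radii in `(0,1)` such that every ray from the origin meets one of them. -/
theorem shadow_rays_three_discs :
    ∃ (c : Fin 3 → EuclideanSpace ℝ (Fin 2)) (r : Fin 3 → ℝ),
      (∀ i, ‖c i‖ = 1) ∧ (∀ i, 0 < r i) ∧ (∀ i, r i < 1) ∧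
      (Pairwise fun i j => Disjoint (Metric.closedBall (c i) (r i))
        (Metric.closedBall (c j) (r j))) ∧
      ∀ v : EuclideanSpace ℝ (Fin 2), v ≠ 0 →
        ∃ (t : ℝ) (i : Fin 3), 0 ≤ t ∧ t • v ∈ Metric.closedBall (c i) (r i) := by
  -- The radii are the sines of the angles of the acute scalene triangle with sides 13, 14, 15;
  -- these angles add up to `π`, so the three shadows exactly tile the circle of directions.
  refine ⟨![!₂[1, 0], !₂[-5/13, 12/13], !₂[-33/65, -56/65]], ![4/5, 56/65, 12/13],
    ?_, ?_, ?_, ?_, ?_⟩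
  · intro i
    rw [EuclideanSpace.norm_eq, Real.sqrt_eq_one, Fin.sum_univ_two]
    fin_cases i <;> norm_num [sq_abs]
  · intro i
    fin_cases i <;> norm_num
  · intro i
    fin_cases i <;> norm_num
  · intro i j hij
    fin_cases i <;> fin_cases j <;> first
      | exact absurd rfl hij
      | (apply disjoint_closedBall_of_sq_lt <;> norm_num)
  · intro v hv
    have hcover : (0 ≤ 4 * v 0 - 3 * v 1 ∧ 0 ≤ 4 * v 0 + 3 * v 1) ∨
        (0 ≤ 3 * v 1 - 4 * v 0 ∧ 0 ≤ 116 * v 0 + 837 * v 1) ∨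
        (116 * v 0 + 837 * v 1 ≤ 0 ∧ 4 * v 0 + 3 * v 1 ≤ 0) := by
      grind
    rcases hcover with ⟨h₁, h₂⟩ | ⟨h₁, h₂⟩ | ⟨h₁, h₂⟩
    · obtain ⟨t, ht, hmem⟩ := exists_nonneg_smul_mem_closedBall (c := !₂[1, 0]) (v := v)
        (r := 4/5) (k := 3/5) (by norm_num) (by norm_num) (by norm_num) hv
        (by simp; linarith) (by simp; linarith)
      exact ⟨t, 0, ht, hmem⟩
    · obtain ⟨t, ht, hmem⟩ := exists_nonneg_smul_mem_closedBall (c := !₂[-5/13, 12/13]) (v := v)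
        (r := 56/65) (k := 33/65) (by norm_num) (by norm_num) (by norm_num) hv
        (by simp; linarith) (by simp; linarith)
      exact ⟨t, 1, ht, hmem⟩
    · obtain ⟨t, ht, hmem⟩ := exists_nonneg_smul_mem_closedBall (c := !₂[-33/65, -56/65]) (v := v)
        (r := 12/13) (k := 5/13) (by norm_num) (by norm_num) (by norm_num) hv
        (by simp; linarith) (by simp; linarith)
      exact ⟨t, 2, ht, hmem⟩
end

section
/- Let D₁, D₂ be two closed discs in the Euclidean plane ℝ², whose centers lie on the unit circle (have norm 1) and whose radii are strictly less than 1. Then there exists a ray emanating from the origin that is disjoint from D₁ ∪ D₂; hence two such discs never suffice to block every ray from the center of the circle. -/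
/-- A ray from the origin making a non-acute angle with `c` misses every closed ball centered
at `c` that does not contain the origin. -/
theorem smul_notMem_closedBall_of_inner_nonpos {E : Type*} [NormedAddCommGroup E]
    [InnerProductSpace ℝ E] {c v : E} {r t : ℝ} (hr : r < ‖c‖) (hv : inner ℝ v c ≤ 0)
    (ht : 0 ≤ t) : t • v ∉ Metric.closedBall c r := by
  rw [Metric.mem_closedBall, dist_eq_norm, not_le]
  refine hr.trans_le (le_of_sq_le_sq ?_ (norm_nonneg _))
  rw [norm_sub_sq_real, real_inner_smul_left]
  nlinarith [sq_nonneg ‖t • v‖, mul_nonneg ht (neg_nonneg.2 hv)]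

/-- Any two unit vectors in the plane admit a nonzero vector making a non-acute angle with
both. -/
theorem exists_ne_zero_inner_nonpos {c₁ c₂ : EuclideanSpace ℝ (Fin 2)}
    (hc₁ : ‖c₁‖ = 1) (hc₂ : ‖c₂‖ = 1) :
    ∃ v : EuclideanSpace ℝ (Fin 2), v ≠ 0 ∧ inner ℝ v c₁ ≤ 0 ∧ inner ℝ v c₂ ≤ 0 := by
  by_cases h : c₁ + c₂ = 0
  · obtain rfl : c₂ = -c₁ := eq_neg_of_add_eq_zero_right h
    have horth : inner ℝ !₂[-c₁ 1, c₁ 0] c₁ = 0 := by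
      simp [PiLp.inner_apply, Fin.sum_univ_two]
      ring
    refine ⟨!₂[-c₁ 1, c₁ 0], fun hv => ?_, horth.le, by rw [inner_neg_right, horth, neg_zero]⟩
    have h0 : c₁ 0 = 0 := by simpa using congrArg (fun x => x 1) hv
    have h1 : c₁ 1 = 0 := by simpa using congrArg (fun x => x 0) hv
    simp [EuclideanSpace.norm_eq, Fin.sum_univ_two, h0, h1] at hc₁
  · have hinner : -1 ≤ inner ℝ c₁ c₂ := by
      have := neg_le_of_abs_le (abs_real_inner_le_norm c₁ c₂)
      simpa [hc₁, hc₂] using this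
    refine ⟨-(c₁ + c₂), neg_ne_zero.2 h, ?_, ?_⟩
    · rw [inner_neg_left, inner_add_left, real_inner_self_eq_norm_sq, hc₁, real_inner_comm]
      linarith
    · rw [inner_neg_left, inner_add_left, real_inner_self_eq_norm_sq, hc₂]
      linarith

/-- Two closed discs in the plane with centers on the unit circle and radii `< 1` never
block every ray from the origin. -/
theorem two_discs_insufficient_rays
    (c₁ c₂ : EuclideanSpace ℝ (Fin 2)) (r₁ r₂ : ℝ)
    (hc₁ : ‖c₁‖ = 1) (hc₂ : ‖c₂‖ = 1) (hr₁ : r₁ < 1) (hr₂ : r₂ < 1) :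
    ∃ v : EuclideanSpace ℝ (Fin 2), v ≠ 0 ∧
      ∀ t : ℝ, 0 ≤ t →
        t • v ∉ Metric.closedBall c₁ r₁ ∪ Metric.closedBall c₂ r₂ := by
  obtain ⟨v, hv, hv₁, hv₂⟩ := exists_ne_zero_inner_nonpos hc₁ hc₂
  exact ⟨v, hv, fun t ht => not_or.2
    ⟨smul_notMem_closedBall_of_inner_nonpos (hc₁ ▸ hr₁) hv₁ ht,
      smul_notMem_closedBall_of_inner_nonpos (hc₂ ▸ hr₂) hv₂ ht⟩⟩
end

section
/- Let n ≥ 1 and let K = ⋃_{i=1}^{n} K_i be a subset of n-dimensional Euclidean space ℝⁿ, where each K_i is a compact convex set. Then K is 1-semiconvex: for every point x ∈ ℝⁿ \ K there exists a ray emanating from x that is disjoint from K. -/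
/-- As many linear functionals as the dimension, when there is at least one, are simultaneously
nonpositive at some nonzero vector. -/
theorem exists_ne_zero_forall_apply_nonpos {ι E : Type*} [Fintype ι] [Nonempty ι]
    [AddCommGroup E] [Module ℝ E] [FiniteDimensional ℝ E]
    (hdim : Module.finrank ℝ E = Fintype.card ι) (f : ι → E →ₗ[ℝ] ℝ) :
    ∃ v : E, v ≠ 0 ∧ ∀ i, f i v ≤ 0 := by
  by_cases hinj : Function.Injective (LinearMap.pi f)
  · have hsurj : Function.Surjective (LinearMap.pi f) :=
      (LinearMap.injective_iff_surjective_of_finrank_eq_finrank (by simpa using hdim)).1 hinj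
    obtain ⟨v, hv⟩ := hsurj fun _ => -1
    have hf : ∀ i, f i v = -1 := fun i => congrFun hv i
    refine ⟨v, ?_, fun i => by rw [hf i]; norm_num⟩
    rintro rfl
    simpa using hf (Classical.arbitrary ι)
  · rw [injective_iff_map_eq_zero] at hinj
    push Not at hinj
    obtain ⟨v, hv, hne⟩ := hinj
    exact ⟨v, hne, fun i => (congrFun hv i).le⟩

/-- A union of `n` compact convex sets in `ℝⁿ` is 1-semiconvex: from every point of the
complement there emanates a ray disjoint from the union. -/
theorem union_compact_convex_semiconvex (n : ℕ) (hn : 1 ≤ n)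
    (K : Fin n → Set (EuclideanSpace ℝ (Fin n)))
    (hcpt : ∀ i, IsCompact (K i)) (hconv : ∀ i, Convex ℝ (K i))
    (x : EuclideanSpace ℝ (Fin n)) (hx : x ∉ ⋃ i, K i) :
    ∃ v : EuclideanSpace ℝ (Fin n), v ≠ 0 ∧
      ∀ t : ℝ, 0 ≤ t → x + t • v ∉ ⋃ i, K i := by
  have : Nonempty (Fin n) := ⟨⟨0, hn⟩⟩
  simp only [Set.mem_iUnion, not_exists] at hx ⊢
  choose f u hfx hfK using fun i =>
    geometric_hahn_banach_point_closed (hconv i) (hcpt i).isClosed (hx i)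
  obtain ⟨v, hv, hfv⟩ := exists_ne_zero_forall_apply_nonpos (by simp)
    fun i => (f i : EuclideanSpace ℝ (Fin n) →ₗ[ℝ] ℝ)
  refine ⟨v, hv, fun t ht i hmem => ?_⟩
  have hlt := (hfx i).trans (hfK i _ hmem)
  have hle : t * f i v ≤ 0 := mul_nonpos_of_nonneg_of_nonpos ht (hfv i)
  simp only [map_add, map_smul, smul_eq_mul] at hlt
  linarith
end

section
/- There exist ten pairwise disjoint closed balls in three-dimensional Euclidean space ℝ³, whose centers lie on the unit sphere S² (have norm 1) and whose radii are positive and strictly less than 1, such that every ray emanating from the origin intersects at least one of these balls. -/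
/-- Closed balls centered on the unit sphere are disjoint as soon as the square of the sum of
their radii is less than the squared distance `2 - 2⟪c, d⟫` of their centers. -/
lemma disjoint_closedBall_of_inner {E : Type*} [NormedAddCommGroup E] [InnerProductSpace ℝ E]
    {c d : E} {r s : ℝ} (hc : ‖c‖ = 1) (hd : ‖d‖ = 1)
    (h : (r + s) ^ 2 < 2 - 2 * inner ℝ c d) :
    Disjoint (Metric.closedBall c r) (Metric.closedBall d s) := by
  apply Metric.closedBall_disjoint_closedBall
  rw [dist_eq_norm]
  apply lt_of_pow_lt_pow_left₀ 2 (norm_nonneg _)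
  rw [norm_sub_sq_real, hc, hd]
  linarith

/-- The ray spanned by `v` meets a ball centered at a unit vector `c` whenever the cosine of the
angle between `v` and `c` is at least `k`, where `1 - r ^ 2 ≤ k ^ 2`. -/
lemma exists_smul_mem_closedBall {E : Type*} [NormedAddCommGroup E] [InnerProductSpace ℝ E]
    {c v : E} {r k : ℝ} (hc : ‖c‖ = 1) (hv : v ≠ 0) (hr : 0 ≤ r) (hk : 0 ≤ k)
    (hkr : 1 - r ^ 2 ≤ k ^ 2) (h : k * ‖v‖ ≤ inner ℝ v c) :
    ∃ t : ℝ, 0 ≤ t ∧ t • v ∈ Metric.closedBall c r := by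
  have hn : 0 < ‖v‖ := norm_pos_iff.mpr hv
  have hi : 0 ≤ inner ℝ v c := le_trans (by positivity) h
  refine ⟨inner ℝ v c / ‖v‖ ^ 2, by positivity, ?_⟩
  rw [Metric.mem_closedBall, dist_eq_norm]
  apply le_of_sq_le_sq _ hr
  have hsq : k ^ 2 ≤ (inner ℝ v c / ‖v‖) ^ 2 :=
    pow_le_pow_left₀ hk ((le_div_iff₀ hn).mpr h) 2
  have hexp : ‖(inner ℝ v c / ‖v‖ ^ 2) • v - c‖ ^ 2 = 1 - (inner ℝ v c / ‖v‖) ^ 2 := by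
    rw [norm_sub_sq_real, hc, norm_smul, inner_smul_left, Real.norm_of_nonneg (by positivity)]
    simp only [conj_trivial]
    field_simp
    ring
  linarith

/-- Half of an octant sector: the diagonal cap and the axis cap cover everything near the
equator. -/
lemma le_or_le_of_near_equator {x y z n : ℝ} (hy : 0 ≤ y) (hyx : y ≤ x) (hn : 0 < n)
    (h : n ^ 2 = x ^ 2 + y ^ 2 + z ^ 2) (hz : z ^ 2 ≤ (0.01 * n) ^ 2) :
    0.91028 * n ≤ x ∨ 1.3241 * n ≤ x + y := by
  by_contra! hcon
  obtain ⟨hx, hxy⟩ := hcon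
  rcases le_total x (0.66205 * n) with hx' | hx'
  · nlinarith
  · nlinarith [mul_nonneg (sub_nonneg.mpr hx') (sub_nonneg.mpr hx.le)]

/-- Centers: the two poles, the four axis points and the four diagonal points of the equator. -/
noncomputable def shadowCenter : Fin 10 → EuclideanSpace ℝ (Fin 3) :=
  ![!₂[0, 0, 1], !₂[0, 0, -1],
    !₂[1, 0, 0], !₂[-1, 0, 0], !₂[0, 1, 0], !₂[0, -1, 0],
    !₂[√2 / 2, √2 / 2, 0], !₂[√2 / 2, -(√2 / 2), 0],
    !₂[-(√2 / 2), √2 / 2, 0], !₂[-(√2 / 2), -(√2 / 2), 0]]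

/-- Radii of the polar, axis and diagonal balls. -/
noncomputable def shadowRadius : Fin 10 → ℝ :=
  ![0.99995, 0.99995, 0.414, 0.414, 0.414, 0.414, 0.3513, 0.3513, 0.3513, 0.3513]

lemma norm_shadowCenter (i : Fin 10) : ‖shadowCenter i‖ = 1 := by
  fin_cases i <;> simp [shadowCenter, EuclideanSpace.norm_eq, Fin.sum_univ_three, div_pow] <;>
    norm_num

lemma sqrt_two_bounds : 1.4142 < √2 ∧ √2 < 1.41422 :=
  ⟨Real.lt_sqrt_of_sq_lt (by norm_num), (Real.sqrt_lt' (by norm_num)).mpr (by norm_num)⟩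

lemma pairwise_disjoint_shadow_balls : Pairwise fun i j =>
    Disjoint (Metric.closedBall (shadowCenter i) (shadowRadius i))
      (Metric.closedBall (shadowCenter j) (shadowRadius j)) := by
  intro i j hij
  apply disjoint_closedBall_of_inner (norm_shadowCenter i) (norm_shadowCenter j)
  have h2 : √2 * √2 = 2 := Real.mul_self_sqrt (by norm_num)
  obtain ⟨hl, hu⟩ := sqrt_two_bounds
  fin_cases i <;> fin_cases j <;> first
    | exact absurd rfl hij
    | (simp [shadowCenter, shadowRadius, PiLp.inner_apply, Fin.sum_univ_three]
       try nlinarith)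

lemma exists_smul_mem_shadow_ball (v : EuclideanSpace ℝ (Fin 3)) (hv : v ≠ 0) :
    ∃ (t : ℝ) (i : Fin 10), 0 ≤ t ∧
      t • v ∈ Metric.closedBall (shadowCenter i) (shadowRadius i) := by
  have hn : 0 < ‖v‖ := norm_pos_iff.mpr hv
  have hsum : ‖v‖ ^ 2 = v 0 ^ 2 + v 1 ^ 2 + v 2 ^ 2 := by
    simp [EuclideanSpace.norm_sq_eq, Fin.sum_univ_three]
  obtain ⟨hl, -⟩ := sqrt_two_bounds
  have hit (i : Fin 10) (k : ℝ) (hr : 0 ≤ shadowRadius i) (hk : 0 ≤ k)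
      (hkr : 1 - shadowRadius i ^ 2 ≤ k ^ 2) (h : k * ‖v‖ ≤ inner ℝ v (shadowCenter i)) :
      ∃ (t : ℝ) (i : Fin 10), 0 ≤ t ∧
        t • v ∈ Metric.closedBall (shadowCenter i) (shadowRadius i) := by
    obtain ⟨t, ht⟩ := exists_smul_mem_closedBall (norm_shadowCenter i) hv hr hk hkr h
    exact ⟨t, i, ht⟩
  have pole (i : Fin 10) (hi : shadowRadius i = 0.99995)
      (h : 0.01 * ‖v‖ ≤ inner ℝ v (shadowCenter i)) :=
    hit i 0.01 (by rw [hi]; norm_num) (by norm_num) (by rw [hi]; norm_num) h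
  have axis (i : Fin 10) (hi : shadowRadius i = 0.414)
      (h : 0.91028 * ‖v‖ ≤ inner ℝ v (shadowCenter i)) :=
    hit i 0.91028 (by rw [hi]; norm_num) (by norm_num) (by rw [hi]; norm_num) h
  have diagonal (i : Fin 10) (w : ℝ) (hi : shadowRadius i = 0.3513)
      (hw : inner ℝ v (shadowCenter i) = √2 / 2 * w) (h : 1.3241 * ‖v‖ ≤ w) :=
    hit i 0.93627 (by rw [hi]; norm_num) (by norm_num) (by rw [hi]; norm_num)
      (by rw [hw]; nlinarith)
  by_cases hz : v 2 ^ 2 ≤ (0.01 * ‖v‖) ^ 2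
  · have sector : (0.91028 * ‖v‖ ≤ |v 0| ∨ 0.91028 * ‖v‖ ≤ |v 1|) ∨
        1.3241 * ‖v‖ ≤ |v 0| + |v 1| := by
      rcases le_total |v 1| |v 0| with h | h
      · rcases le_or_le_of_near_equator (abs_nonneg _) h hn
          (by simpa only [sq_abs] using hsum) hz with h' | h'
        · exact .inl (.inl h')
        · exact .inr h'
      · rcases le_or_le_of_near_equator (abs_nonneg _) h hn
          (by simp only [sq_abs]; linarith) hz with h' | h'
        · exact .inl (.inr h')
        · exact .inr (by linarith)
    rcases sector with (h | h) | h
    · rcases le_abs.mp h with h | h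
      · exact axis 2 rfl (by simpa [shadowCenter, PiLp.inner_apply, Fin.sum_univ_three] using h)
      · exact axis 3 rfl (by simpa [shadowCenter, PiLp.inner_apply, Fin.sum_univ_three] using h)
    · rcases le_abs.mp h with h | h
      · exact axis 4 rfl (by simpa [shadowCenter, PiLp.inner_apply, Fin.sum_univ_three] using h)
      · exact axis 5 rfl (by simpa [shadowCenter, PiLp.inner_apply, Fin.sum_univ_three] using h)
    · rcases abs_choice (v 0) with h0 | h0 <;> rcases abs_choice (v 1) with h1 | h1 <;>
        rw [h0, h1] at h
      · exact diagonal 6 _ rfl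
          (by simp [shadowCenter, PiLp.inner_apply, Fin.sum_univ_three]; ring) h
      · exact diagonal 7 _ rfl
          (by simp [shadowCenter, PiLp.inner_apply, Fin.sum_univ_three]; ring) h
      · exact diagonal 8 _ rfl
          (by simp [shadowCenter, PiLp.inner_apply, Fin.sum_univ_three]; ring) h
      · exact diagonal 9 _ rfl
          (by simp [shadowCenter, PiLp.inner_apply, Fin.sum_univ_three]; ring) h
  · have h : 0.01 * ‖v‖ ≤ |v 2| := by
      rw [not_le, sq_lt_sq, abs_of_nonneg (by positivity)] at hz
      exact hz.le
    rcases le_abs.mp h with h | h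
    · exact pole 0 rfl (by simpa [shadowCenter, PiLp.inner_apply, Fin.sum_univ_three] using h)
    · exact pole 1 rfl (by simpa [shadowCenter, PiLp.inner_apply, Fin.sum_univ_three] using h)

/-- There exist ten pairwise disjoint closed balls in `ℝ³` with centers on the unit sphere
and radii in `(0,1)` such that every ray from the origin meets one of them. -/
theorem shadow_rays_ten_balls :
    ∃ (c : Fin 10 → EuclideanSpace ℝ (Fin 3)) (r : Fin 10 → ℝ),
      (∀ i, ‖c i‖ = 1) ∧ (∀ i, 0 < r i) ∧ (∀ i, r i < 1) ∧
      (Pairwise fun i j => Disjoint (Metric.closedBall (c i) (r i))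
        (Metric.closedBall (c j) (r j))) ∧
      ∀ v : EuclideanSpace ℝ (Fin 3), v ≠ 0 →
        ∃ (t : ℝ) (i : Fin 10), 0 ≤ t ∧ t • v ∈ Metric.closedBall (c i) (r i) := by
  refine ⟨shadowCenter, shadowRadius, norm_shadowCenter, ?_, ?_,
    pairwise_disjoint_shadow_balls, exists_smul_mem_shadow_ball⟩ <;>
  · intro i
    fin_cases i <;> norm_num [shadowRadius]
end

section
/- Let A, B, C be affinely independent points in the Euclidean plane ℝ², let a = ‖B − C‖, b = ‖C − A‖, c = ‖A − B‖, and p = (a + b + c)/2. Let D_A, D_B, D_C be the closed discs centered at A, B, C of radii p − a, p − b, p − c respectively. Then for every point x in the convex hull of {A, B, C}, every ray emanating from x intersects D_A ∪ D_B ∪ D_C. -/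
/-- Two closed balls whose radii sum to the distance of their centres cover the segment
joining the centres. -/
lemma segment_subset_closedBall_union {E : Type*} [SeminormedAddCommGroup E] [NormedSpace ℝ E]
    {P Q : E} {r s : ℝ} (h : dist P Q ≤ r + s) :
    segment ℝ P Q ⊆ Metric.closedBall P r ∪ Metric.closedBall Q s := by
  intro y hy
  have hd := dist_add_dist_of_mem_segment hy
  rw [Set.mem_union, Metric.mem_closedBall, Metric.mem_closedBall, dist_comm y P]
  by_contra! hcon
  linarith

/-- Every ray starting in a simplex hits a facet of that simplex. -/
lemma AffineBasis.exists_ray_coord_eq_zero {ι E : Type*} [Fintype ι] [AddCommGroup E]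
    [Module ℝ E] (b : AffineBasis ι ℝ E) {x v : E} (hx : ∀ i, 0 ≤ b.coord i x) (hv : v ≠ 0) :
    ∃ t : ℝ, 0 ≤ t ∧ (∀ i, 0 ≤ b.coord i (x + t • v)) ∧ ∃ i, b.coord i (x + t • v) = 0 := by
  classical
  have hcoord (t : ℝ) (i : ι) :
      b.coord i (x + t • v) = b.coord i x + t * (b.coord i).linear v := by
    have := (b.coord i).map_vadd x (t • v)
    simp only [vadd_eq_add, map_smul, smul_eq_mul] at this
    rw [add_comm x, this, add_comm]
  have hsum : ∑ i, (b.coord i).linear v = 0 := by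
    have h := b.sum_coord_apply_eq_one (x + (1 : ℝ) • v)
    simp only [hcoord, Finset.sum_add_distrib, b.sum_coord_apply_eq_one, one_mul] at h
    linarith
  obtain ⟨j, hj⟩ : ∃ j, (b.coord j).linear v < 0 := by
    by_contra! hcon
    have hzero (i : ι) : (b.coord i).linear v = 0 :=
      (Finset.sum_eq_zero_iff_of_nonneg fun i _ ↦ hcon i).1 hsum i (Finset.mem_univ i)
    have hxv : x + (1 : ℝ) • v = x := b.ext_elem fun i ↦ by rw [hcoord, hzero]; ring
    exact hv (by simpa using hxv)
  obtain ⟨i, hi, hmin⟩ := Finset.exists_min_image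
    (Finset.univ.filter fun i ↦ (b.coord i).linear v < 0)
    (fun i ↦ b.coord i x / -(b.coord i).linear v) ⟨j, by simpa using hj⟩
  simp only [Finset.mem_filter, Finset.mem_univ, true_and] at hi hmin
  have ht : 0 ≤ b.coord i x / -(b.coord i).linear v := div_nonneg (hx i) (by linarith)
  refine ⟨_, ht, fun k ↦ ?_, i, ?_⟩
  · rw [hcoord]
    rcases lt_or_ge ((b.coord k).linear v) 0 with hk | hk
    · have h := hmin k hk
      rw [le_div_iff₀ (by linarith)] at h
      linarith
    · exact add_nonneg (hx k) (mul_nonneg ht hk)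
  · rw [hcoord]
    rw [div_neg, neg_mul, div_mul_cancel₀ _ hi.ne, add_neg_cancel]

/-- For a triangle `ABC` in the plane with side lengths `a, b, c` and semiperimeter `p`,
the closed discs centered at `A, B, C` with radii `p-a, p-b, p-c` block every ray emanating
from any point of the triangle. -/
theorem triangle_discs_block_rays
    (A B C : EuclideanSpace ℝ (Fin 2)) (hABC : AffineIndependent ℝ ![A, B, C])
    (a b c p : ℝ) (ha : a = ‖B - C‖) (hb : b = ‖C - A‖) (hc : c = ‖A - B‖)
    (hp : p = (a + b + c) / 2)
    (x : EuclideanSpace ℝ (Fin 2)) (hx : x ∈ convexHull ℝ {A, B, C}) :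
    ∀ v : EuclideanSpace ℝ (Fin 2), v ≠ 0 →
      ∃ t : ℝ, 0 ≤ t ∧ x + t • v ∈
        Metric.closedBall A (p - a) ∪ Metric.closedBall B (p - b) ∪
          Metric.closedBall C (p - c) := by
  intro v hv
  let β : AffineBasis (Fin 3) ℝ (EuclideanSpace ℝ (Fin 2)) :=
    ⟨![A, B, C], hABC, hABC.affineSpan_eq_top_iff_card_eq_finrank_add_one.2 (by simp)⟩
  have hrange : Set.range β = {A, B, C} := by
    change Set.range ![A, B, C] = _
    simp only [Matrix.range_cons, Matrix.range_empty, Set.union_empty, Set.singleton_union]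
  rw [← hrange, β.convexHull_eq_nonneg_coord] at hx
  obtain ⟨t, ht, hnonneg, i, hi⟩ := β.exists_ray_coord_eq_zero hx hv
  refine ⟨t, ht, ?_⟩
  generalize x + t • v = y at hnonneg hi
  have hsum := β.sum_coord_apply_eq_one y
  have hy : ∑ i, β.coord i y • ![A, B, C] i = y := β.linear_combination_coord_eq_self y
  simp only [Fin.sum_univ_three, Matrix.cons_val] at hsum hy
  have hAB : segment ℝ A B ⊆ Metric.closedBall A (p - a) ∪ Metric.closedBall B (p - b) :=
    segment_subset_closedBall_union (by rw [dist_eq_norm]; linarith)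
  have hBC : segment ℝ B C ⊆ Metric.closedBall B (p - b) ∪ Metric.closedBall C (p - c) :=
    segment_subset_closedBall_union (by rw [dist_eq_norm]; linarith)
  have hCA : segment ℝ C A ⊆ Metric.closedBall C (p - c) ∪ Metric.closedBall A (p - a) :=
    segment_subset_closedBall_union (by rw [dist_eq_norm]; linarith)
  have h0 := hnonneg 0
  have h1 := hnonneg 1
  have h2 := hnonneg 2
  fin_cases i
  · have hi : β.coord 0 y = 0 := hi
    rw [hi, zero_smul, zero_add] at hy
    rcases hBC ⟨_, _, h1, h2, by linarith, hy⟩ with h | h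
    · exact Or.inl (Or.inr h)
    · exact Or.inr h
  · have hi : β.coord 1 y = 0 := hi
    rw [hi, zero_smul, add_zero, add_comm] at hy
    rcases hCA ⟨_, _, h2, h0, by linarith, hy⟩ with h | h
    · exact Or.inr h
    · exact Or.inl (Or.inl h)
  · have hi : β.coord 2 y = 0 := hi
    rw [hi, zero_smul, add_zero] at hy
    exact Or.inl (hAB ⟨_, _, h0, h1, by linarith, hy⟩)
end
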